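/- arXiv:1703.06768 — 7 statements merged into one kernel-verified Lean document; each statement's English description precedes it below -/
import Mathlib

section
/- Suppose φ is an angle with r_A·cos(θ−φ) − r > 0 and r_B·cos(θ+φ) − r > 0, and with cos φ ≠ 0 and cos θ ≠ 0. If the equal-ratio (similar triangles) relation r_A·sin(θ−φ)·(r_B·cos(θ+φ) − r) = r_B·sin(θ+φ)·(r_A·cos(θ−φ) − r) holds, then (1 + tan²φ)·((r/r_A − r/r_B)·tan θ + (r/r_A + r/r_B)·tan φ)² = 4·tan²φ·(1 + tan²θ). -/
open Real

/-- If the similar-triangles equal-ratio relation holds at polar angle `φ` (with both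
denominators positive and the tangents well defined), then the quartic trigonometric
identity of the specular-reflection problem holds. -/
theorem specular_ratio_implies_quartic_identity
    (r rA rB θ φ : ℝ)
    (hr : 0 < r) (hrA : r < rA) (hAB : rA ≤ rB)
    (hθ0 : 0 < θ) (hθ1 : θ < π / 2)
    (h1 : rA * Real.cos (θ - φ) - r > 0)
    (h2 : rB * Real.cos (θ + φ) - r > 0)
    (hcφ : Real.cos φ ≠ 0) (hcθ : Real.cos θ ≠ 0)
    (heq : rA * Real.sin (θ - φ) * (rB * Real.cos (θ + φ) - r)
         = rB * Real.sin (θ + φ) * (rA * Real.cos (θ - φ) - r)) :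
    (1 + Real.tan φ ^ 2) *
        ((r / rA - r / rB) * Real.tan θ + (r / rA + r / rB) * Real.tan φ) ^ 2
      = 4 * Real.tan φ ^ 2 * (1 + Real.tan θ ^ 2) := by
  have hA : rA ≠ 0 := by linarith
  have hB : rB ≠ 0 := by linarith
  have hlin : 2 * rA * rB * sin φ * cos φ
      = r * ((rB - rA) * sin θ * cos φ + (rB + rA) * cos θ * sin φ) := by
    rw [sin_sub, sin_add, cos_sub, cos_add] at heq
    linear_combination (-1) * heq - 2 * rA * rB * sin φ * cos φ * sin_sq_add_cos_sq θ
  have hsum : (r / rA - r / rB) * tan θ + (r / rA + r / rB) * tan φ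
      = 2 * sin φ / cos θ := by
    rw [tan_eq_sin_div_cos, tan_eq_sin_div_cos]
    field_simp
    linear_combination -hlin
  have hsec (x : ℝ) (hx : cos x ≠ 0) : 1 + tan x ^ 2 = 1 / cos x ^ 2 := by
    rw [← inv_one_add_tan_sq hx, one_div, inv_inv]
  rw [hsum, hsec φ hcφ, hsec θ hcθ, tan_eq_sin_div_cos]
  field_simp
  ring
end

section
/- Suppose 0 < r < r_A < r_B and 0 < 2θ < arccos((r² − √((r_A² − r²)·(r_B² − r²)))/(r_A·r_B)). Set a = r/r_A, b = r/r_B, T = tan θ. Then the quartic polynomial P(t) = (a + b)²·t⁴ + 2·(a − b)·(a + b)·T·t³ + ((a − b)²·T² + (a + b)² − 4·(1 + T²))·t² + 2·(a − b)·(a + b)·T·t + (a − b)²·T² has four distinct real roots. -/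
open Real Set

/-- The specular quartic, as the difference of its two sides before expansion. -/
def specularQuartic (d s T t : ℝ) : ℝ :=
  (1 + t ^ 2) * (d * T + s * t) ^ 2 - 4 * t ^ 2 * (1 + T ^ 2)

lemma continuous_specularQuartic (d s T : ℝ) : Continuous (specularQuartic d s T) := by
  unfold specularQuartic
  fun_prop

lemma specularQuartic_pos_of_le_sq {d s T t : ℝ}
    (h : 4 * (1 + T ^ 2) ≤ (d * T + s * t) ^ 2) : 0 < specularQuartic d s T t := by
  unfold specularQuartic
  nlinarith [mul_le_mul_of_nonneg_left h (sq_nonneg t), sq_nonneg T]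

lemma exists_four_zeros_of_sign_changes {f : ℝ → ℝ} (hf : Continuous f) {x₀ x₁ x₂ x₃ x₄ : ℝ}
    (h₀₁ : x₀ < x₁) (h₁₂ : x₁ < x₂) (h₂₃ : x₂ < x₃) (h₃₄ : x₃ < x₄)
    (hx₀ : 0 < f x₀) (hx₁ : f x₁ < 0) (hx₂ : 0 < f x₂) (hx₃ : f x₃ < 0) (hx₄ : 0 < f x₄) :
    ∃ t₁ t₂ t₃ t₄ : ℝ, t₁ < t₂ ∧ t₂ < t₃ ∧ t₃ < t₄ ∧
      f t₁ = 0 ∧ f t₂ = 0 ∧ f t₃ = 0 ∧ f t₄ = 0 := by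
  obtain ⟨t₁, ⟨_, h₁⟩, e₁⟩ := intermediate_value_Ioo' h₀₁.le hf.continuousOn ⟨hx₁, hx₀⟩
  obtain ⟨t₂, ⟨h₂, h₂'⟩, e₂⟩ := intermediate_value_Ioo h₁₂.le hf.continuousOn ⟨hx₁, hx₂⟩
  obtain ⟨t₃, ⟨h₃, h₃'⟩, e₃⟩ := intermediate_value_Ioo' h₂₃.le hf.continuousOn ⟨hx₃, hx₂⟩
  obtain ⟨t₄, ⟨h₄, _⟩, e₄⟩ := intermediate_value_Ioo h₃₄.le hf.continuousOn ⟨hx₃, hx₄⟩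
  exact ⟨t₁, t₂, t₃, t₄, h₁.trans h₂, h₂'.trans h₃, h₃'.trans h₄, e₁, e₂, e₃, e₄⟩

/-- For `0 < b < a < 1` and `0 < T` the specular quartic changes sign at
`-(a - b) * T / (a + b)`, `0` and `T`. -/
lemma exists_four_zeros_specularQuartic {a b T : ℝ} (hb : 0 < b) (hba : b < a) (ha : a < 1)
    (hT : 0 < T) :
    ∃ t₁ t₂ t₃ t₄ : ℝ, t₁ < t₂ ∧ t₂ < t₃ ∧ t₃ < t₄ ∧
      specularQuartic (a - b) (a + b) T t₁ = 0 ∧ specularQuartic (a - b) (a + b) T t₂ = 0 ∧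
      specularQuartic (a - b) (a + b) T t₃ = 0 ∧ specularQuartic (a - b) (a + b) T t₄ = 0 := by
  have hs : 0 < a + b := by linarith
  have hdT : 0 < (a - b) * T := mul_pos (sub_pos.2 hba) hT
  obtain ⟨M, hM⟩ : ∃ M, (a + b) * M = (a - b) * T + 2 * (1 + T ^ 2) :=
    ⟨_, mul_div_cancel₀ _ hs.ne'⟩
  obtain ⟨z, hz⟩ : ∃ z, (a + b) * z = (a - b) * T := ⟨_, mul_div_cancel₀ _ hs.ne'⟩
  have hz0 : 0 < z := pos_of_mul_pos_right (hz ▸ hdT) hs.le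
  have hzM : z < M := lt_of_mul_lt_mul_left (by nlinarith) hs.le
  have hTM : T < M := lt_of_mul_lt_mul_left (by nlinarith [sq_nonneg (T - 1)]) hs.le
  refine exists_four_zeros_of_sign_changes (continuous_specularQuartic _ _ _)
    (neg_lt_neg hzM) (neg_neg_of_pos hz0) hT hTM ?_ ?_ ?_ ?_ ?_
  · apply specularQuartic_pos_of_le_sq
    rw [mul_neg, hM]
    nlinarith [sq_nonneg T, sq_nonneg (T ^ 2)]
  · unfold specularQuartic
    rw [mul_neg, hz, add_neg_cancel]
    have : 0 < z ^ 2 * (1 + T ^ 2) := by positivity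
    linarith
  · unfold specularQuartic
    nlinarith [pow_pos hdT 2]
  · have h : specularQuartic (a - b) (a + b) T T = -(4 * T ^ 2 * (1 + T ^ 2) * (1 - a ^ 2)) := by
      unfold specularQuartic
      ring
    have : 0 < 1 - a ^ 2 := by nlinarith
    rw [h]
    exact neg_neg_of_pos (by positivity)
  · apply specularQuartic_pos_of_le_sq
    rw [hM]
    nlinarith [sq_nonneg T, sq_nonneg (T ^ 2), mul_nonneg hdT.le (sq_nonneg T)]

/-- Under the geometric admissibility condition on the half-angle `θ`, the quartic
polynomial form of the specular-reflection equation has four distinct real roots. -/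
theorem specular_quartic_four_distinct_real_roots
    (r rA rB θ : ℝ)
    (hr : 0 < r) (hrA : r < rA) (hAB : rA < rB)
    (hθ0 : 0 < 2 * θ)
    (hθ1 : 2 * θ <
      Real.arccos ((r ^ 2 - Real.sqrt ((rA ^ 2 - r ^ 2) * (rB ^ 2 - r ^ 2))) / (rA * rB)))
    (a b T : ℝ) (ha : a = r / rA) (hb : b = r / rB) (hT : T = Real.tan θ) :
    ∃ t₁ t₂ t₃ t₄ : ℝ,
      t₁ ≠ t₂ ∧ t₁ ≠ t₃ ∧ t₁ ≠ t₄ ∧ t₂ ≠ t₃ ∧ t₂ ≠ t₄ ∧ t₃ ≠ t₄ ∧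
      ∀ t ∈ ({t₁, t₂, t₃, t₄} : Set ℝ),
        (a + b) ^ 2 * t ^ 4 + 2 * (a - b) * (a + b) * T * t ^ 3
          + ((a - b) ^ 2 * T ^ 2 + (a + b) ^ 2 - 4 * (1 + T ^ 2)) * t ^ 2
          + 2 * (a - b) * (a + b) * T * t + (a - b) ^ 2 * T ^ 2 = 0 := by
  have hT0 : 0 < T := by
    rw [hT]
    exact tan_pos_of_pos_of_lt_pi_div_two (by linarith)
      (by linarith [hθ1.trans_le (arccos_le_pi _)])
  have hrA0 : 0 < rA := hr.trans hrA
  obtain ⟨t₁, t₂, t₃, t₄, h₁₂, h₂₃, h₃₄, e₁, e₂, e₃, e₄⟩ :=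
    exists_four_zeros_specularQuartic (a := a) (b := b)
      (hb ▸ div_pos hr (hrA0.trans hAB)) (by rw [ha, hb]; gcongr)
      (by rwa [ha, div_lt_one hrA0]) hT0
  refine ⟨t₁, t₂, t₃, t₄, h₁₂.ne, (h₁₂.trans h₂₃).ne, (h₁₂.trans (h₂₃.trans h₃₄)).ne, h₂₃.ne,
    (h₂₃.trans h₃₄).ne, h₃₄.ne, fun t ht => ?_⟩
  have hzero : specularQuartic (a - b) (a + b) T t = 0 := by
    rcases ht with rfl | rfl | rfl | rfl <;> assumption
  unfold specularQuartic at hzero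
  linear_combination hzero
end

section
/- Assume cos(2θ) > (r² − √((r_A² − r²)·(r_B² − r²)))/(r_A·r_B). Then the iteration map f is a contraction with constant 1/2 on the interval [0, φ_⊥]: for all φ, ψ ∈ [0, φ_⊥], |f(φ) − f(ψ)| ≤ (1/2)·|φ − ψ|. -/
open Real

/-- The distance from the origin to the line through the points at polar angles `δ` and `0` on the
circles of radius `r` and `R` respectively, signed by `sin δ`. -/
noncomputable def chordDist (r R δ : ℝ) : ℝ :=
  r * R * sin δ / √(r ^ 2 + R ^ 2 - 2 * r * R * cos δ)

/-- The polar angle at which the segment from the point at polar angle `δ` on the circle of radius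
`r` to the point `(R, 0)` crosses the circle of radius `a`, for `r < a ≤ R`. -/
noncomputable def crossingAngle (r a R δ : ℝ) : ℝ :=
  arcsin (chordDist r R δ / a) - arcsin (chordDist r R δ / R)

lemma sq_dist_polar_pos {r R : ℝ} (hr : 0 < r) (hR : r < R) (δ : ℝ) :
    0 < r ^ 2 + R ^ 2 - 2 * r * R * cos δ := by
  nlinarith [mul_le_mul_of_nonneg_left (cos_le_one δ) (mul_pos hr (hr.trans hR)).le,
    pow_pos (sub_pos.2 hR) 2]

lemma sq_add_chordDist_sq {r R : ℝ} (hr : 0 < r) (hR : r < R) (δ : ℝ) :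
    ((r * R * cos δ - r ^ 2) / √(r ^ 2 + R ^ 2 - 2 * r * R * cos δ)) ^ 2
      + chordDist r R δ ^ 2 = r ^ 2 := by
  have hq := sq_dist_polar_pos hr hR δ
  rw [chordDist, div_pow, div_pow, sq_sqrt hq.le, ← add_div, div_eq_iff hq.ne']
  linear_combination r ^ 2 * R ^ 2 * sin_sq_add_cos_sq δ

lemma sq_add_chordDist_sq' {r R : ℝ} (hr : 0 < r) (hR : r < R) (δ : ℝ) :
    ((R ^ 2 - r * R * cos δ) / √(r ^ 2 + R ^ 2 - 2 * r * R * cos δ)) ^ 2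
      + chordDist r R δ ^ 2 = R ^ 2 := by
  have hq := sq_dist_polar_pos hr hR δ
  rw [chordDist, div_pow, div_pow, sq_sqrt hq.le, ← add_div, div_eq_iff hq.ne']
  linear_combination r ^ 2 * R ^ 2 * sin_sq_add_cos_sq δ

lemma far_endpoint_pos {r R : ℝ} (hr : 0 < r) (hR : r < R) (δ : ℝ) :
    0 < (R ^ 2 - r * R * cos δ) / √(r ^ 2 + R ^ 2 - 2 * r * R * cos δ) := by
  refine div_pos ?_ (sqrt_pos.2 (sq_dist_polar_pos hr hR δ))
  nlinarith [mul_le_mul_of_nonneg_left (cos_le_one δ) (mul_pos hr (hr.trans hR)).le,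
    mul_pos (hr.trans hR) (sub_pos.2 hR)]

lemma endpoint_sub_endpoint {r R : ℝ} (hr : 0 < r) (hR : r < R) (δ : ℝ) :
    (R ^ 2 - r * R * cos δ) / √(r ^ 2 + R ^ 2 - 2 * r * R * cos δ)
      - (r * R * cos δ - r ^ 2) / √(r ^ 2 + R ^ 2 - 2 * r * R * cos δ)
      = √(r ^ 2 + R ^ 2 - 2 * r * R * cos δ) := by
  have hq := sq_dist_polar_pos hr hR δ
  rw [← sub_div, div_eq_iff (sqrt_pos.2 hq).ne', mul_self_sqrt hq.le]
  ring

lemma hasDerivAt_chordDist {r R : ℝ} (hr : 0 < r) (hR : r < R) (δ : ℝ) :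
    HasDerivAt (chordDist r R)
      ((r * R * cos δ - r ^ 2) / √(r ^ 2 + R ^ 2 - 2 * r * R * cos δ)
        * ((R ^ 2 - r * R * cos δ) / √(r ^ 2 + R ^ 2 - 2 * r * R * cos δ))
        / √(r ^ 2 + R ^ 2 - 2 * r * R * cos δ)) δ := by
  have hq := sq_dist_polar_pos hr hR δ
  have hD := (sqrt_pos.2 hq).ne'
  have h1 : HasDerivAt (fun x => r ^ 2 + R ^ 2 - 2 * r * R * cos x)
      (-(2 * r * R * -sin δ)) δ := by
    simpa using ((hasDerivAt_cos δ).const_mul (2 * r * R)).const_sub (r ^ 2 + R ^ 2)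
  have h2 := ((hasDerivAt_sin δ).const_mul (r * R)).fun_div (h1.sqrt hq.ne') hD
  refine h2.congr_deriv ?_
  have hs := sq_sqrt hq.le
  set D := √(r ^ 2 + R ^ 2 - 2 * r * R * cos δ)
  field_simp
  rw [hs]
  linear_combination (-R ^ 2 * r) * sin_sq_add_cos_sq δ

lemma HasDerivAt.arcsin_div_const {g : ℝ → ℝ} {g' a x : ℝ} (hg : HasDerivAt g g' x) (ha : 0 < a)
    (h : g x ^ 2 < a ^ 2) :
    HasDerivAt (fun y => arcsin (g y / a)) (g' / √(a ^ 2 - g x ^ 2)) x := by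
  have habs := abs_lt.1 (abs_lt_of_sq_lt_sq h ha.le)
  have h1 : -1 < g x / a := by rw [lt_div_iff₀ ha]; linarith
  have h2 : g x / a < 1 := by rw [div_lt_iff₀ ha]; linarith
  have := (hasDerivAt_arcsin h1.ne' h2.ne).comp x (hg.div_const a)
  refine this.congr_deriv ?_
  have e : 1 - (g x / a) ^ 2 = (a ^ 2 - g x ^ 2) / a ^ 2 := by field_simp
  have hs := (sqrt_pos.2 (sub_pos.2 h)).ne'
  rw [e, sqrt_div (sub_pos.2 h).le, sqrt_sq ha.le]
  field_simp

lemma abs_div_sub_div_le_one {m s b : ℝ} (hs : 0 < s) (hsb : s ≤ b) (hms : |m| ≤ s)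
    (hmb : m < b) : |m * b / (b - m) / s - m * b / (b - m) / b| ≤ 1 := by
  have hb := hs.trans_le hsb
  have hD := sub_pos.2 hmb
  have e : m * b / (b - m) / s - m * b / (b - m) / b = m * (b - s) / ((b - m) * s) := by
    field_simp
  rw [e, abs_div, abs_mul, abs_of_nonneg (sub_nonneg.2 hsb), abs_of_pos (mul_pos hD hs),
    div_le_one (mul_pos hD hs)]
  nlinarith [mul_le_mul_of_nonneg_right hms hb.le, mul_le_mul_of_nonneg_right (le_abs_self m) hs.le]

lemma abs_crossingAngle_sub_le {r a R : ℝ} (hr : 0 < r) (ha : r < a) (hR : a ≤ R) (x y : ℝ) :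
    |crossingAngle r a R x - crossingAngle r a R y| ≤ |x - y| := by
  have hrR := ha.trans_le hR
  have key : ∀ δ, ∃ d, HasDerivAt (crossingAngle r a R) d δ ∧ |d| ≤ 1 := by
    intro δ
    have hm := sq_add_chordDist_sq hr hrR δ
    have hb := sq_add_chordDist_sq' hr hrR δ
    have hb0 := far_endpoint_pos hr hrR δ
    have hD := endpoint_sub_endpoint hr hrR δ
    have hD0 := sqrt_pos.2 (sq_dist_polar_pos hr hrR δ)
    have hp := hasDerivAt_chordDist hr hrR δ
    rw [← hD] at hD0
    set m := (r * R * cos δ - r ^ 2) / √(r ^ 2 + R ^ 2 - 2 * r * R * cos δ)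
    set b := (R ^ 2 - r * R * cos δ) / √(r ^ 2 + R ^ 2 - 2 * r * R * cos δ)
    set p := chordDist r R δ with hpdef
    rw [← hD] at hp
    have hra2 : r ^ 2 < a ^ 2 := by gcongr
    have haR2 : a ^ 2 ≤ R ^ 2 := by have := hr.trans ha; gcongr
    have hpa : p ^ 2 < a ^ 2 := by nlinarith [sq_nonneg m]
    have hpR : p ^ 2 < R ^ 2 := by linarith
    refine ⟨_, (hp.arcsin_div_const (hr.trans ha) hpa).sub
      (hp.arcsin_div_const (hr.trans hrR) hpR), ?_⟩
    have eb : √(R ^ 2 - p ^ 2) = b := by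
      rw [← hb, add_sub_cancel_right, sqrt_sq hb0.le]
    rw [← hpdef, eb]
    refine abs_div_sub_div_le_one (sqrt_pos.2 (sub_pos.2 hpa)) ?_ ?_ (sub_pos.1 hD0)
    · rw [← eb]; gcongr
    · apply abs_le_sqrt; linarith
  choose d hd hd1 using key
  simpa using Convex.norm_image_sub_le_of_norm_hasDerivWithin_le (s := Set.univ) (C := 1)
    (fun z _ => (hd z).hasDerivWithinAt) (fun z _ => hd1 z) convex_univ
    (Set.mem_univ y) (Set.mem_univ x)

lemma abs_lt_pi_div_two_of_cos_pos {x : ℝ} (h1 : -(3 * π / 2) ≤ x) (h2 : x ≤ 3 * π / 2)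
    (h : 0 < cos x) : -(π / 2) < x ∧ x < π / 2 := by
  constructor
  · by_contra! hx
    have := cos_nonpos_of_pi_div_two_le_of_le (x := -x) (by linarith) (by linarith)
    rw [cos_neg] at this
    linarith
  · by_contra! hx
    have := cos_nonpos_of_pi_div_two_le_of_le hx (by linarith)
    linarith

lemma eq_crossingAngle {r a R δ ζ t : ℝ} (hr : 0 < r) (ha : r < a) (hR : a ≤ R)
    (hδ : 0 ≤ cos δ) (ht0 : 0 ≤ t) (ht1 : t ≤ 1)
    (hζ1 : -(3 * π / 2) ≤ ζ) (hζ2 : ζ ≤ 3 * π / 2)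
    (hcos : a * cos ζ = (1 - t) * (r * cos δ) + t * R)
    (hsin : a * sin ζ = (1 - t) * (r * sin δ)) :
    ζ = crossingAngle r a R δ := by
  have hrR := ha.trans_le hR
  have ha0 := hr.trans ha
  have hR0 := hr.trans hrR
  have hra2 : r ^ 2 < a ^ 2 := by gcongr
  have hcosζ : 0 < cos ζ := by
    have ht : 0 < t := by
      refine ht0.lt_of_ne fun h => ?_
      rw [← h, sub_zero, one_mul] at hcos hsin
      rw [zero_mul, add_zero] at hcos
      refine hra2.ne' ?_
      linear_combination (a * cos ζ + r * cos δ) * hcos + (a * sin ζ + r * sin δ) * hsin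
        - a ^ 2 * sin_sq_add_cos_sq ζ + r ^ 2 * sin_sq_add_cos_sq δ
    have : 0 < a * cos ζ := by
      rw [hcos]
      have := mul_nonneg (sub_nonneg.2 ht1) (mul_nonneg hr.le hδ)
      positivity
    exact (mul_pos_iff_of_pos_left ha0).1 this
  have hζ := abs_lt_pi_div_two_of_cos_pos hζ1 hζ2 hcosζ
  have hm := sq_add_chordDist_sq hr hrR δ
  have hb := sq_add_chordDist_sq' hr hrR δ
  have hb0 := far_endpoint_pos hr hrR δ
  have hD := endpoint_sub_endpoint hr hrR δ
  have hD0 := sqrt_pos.2 (sq_dist_polar_pos hr hrR δ)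
  have hpd : chordDist r R δ * √(r ^ 2 + R ^ 2 - 2 * r * R * cos δ) = r * R * sin δ :=
    div_mul_cancel₀ _ hD0.ne'
  have hmd := div_mul_cancel₀ (r * R * cos δ - r ^ 2) hD0.ne'
  have hbd := div_mul_cancel₀ (R ^ 2 - r * R * cos δ) hD0.ne'
  set m := (r * R * cos δ - r ^ 2) / √(r ^ 2 + R ^ 2 - 2 * r * R * cos δ)
  set b := (R ^ 2 - r * R * cos δ) / √(r ^ 2 + R ^ 2 - 2 * r * R * cos δ)
  set p := chordDist r R δ with hp
  set D := √(r ^ 2 + R ^ 2 - 2 * r * R * cos δ)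
  have hpR : |p / R| < 1 := by
    rw [abs_div, abs_of_pos hR0, div_lt_one hR0]
    refine abs_lt_of_sq_lt_sq ?_ hR0.le
    nlinarith [pow_pos hb0 2]
  have hsinγ : sin (arcsin (p / R)) = p / R :=
    sin_arcsin (abs_lt.1 hpR).1.le (abs_lt.1 hpR).2.le
  have hcosγ : cos (arcsin (p / R)) = b / R := by
    rw [cos_arcsin, ← sqrt_sq (div_pos hb0 hR0).le]
    congr 1
    field_simp
    linarith
  have hγ := arcsin_mem_Icc (p / R)
  set γ := arcsin (p / R) with hγdef
  have hS : sin (ζ + γ) = p / a := by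
    rw [eq_div_iff ha0.ne', sin_add, hsinγ, hcosγ]
    field_simp
    apply mul_right_cancel₀ hD0.ne'
    linear_combination b * D * hsin + p * D * hcos + (1 - t) * r * sin δ * hbd
      + ((1 - t) * r * cos δ + t * R - R) * hpd
  have hC : a * cos (ζ + γ) = (1 - t) * m + t * b := by
    rw [cos_add, hsinγ, hcosγ]
    field_simp
    apply mul_right_cancel₀ hD0.ne'
    linear_combination b * D * hcos - p * D * hsin + ((1 - t) * r * cos δ + t * R - R * t) * hbd
      - R * (1 - t) * hmd - (1 - t) * r * sin δ * hpd
      - (1 - t) * r ^ 2 * R * sin_sq_add_cos_sq δ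
  have hCsq : (a * cos (ζ + γ)) ^ 2 = a ^ 2 - p ^ 2 := by
    have h := sin_sq_add_cos_sq (ζ + γ)
    rw [hS] at h
    field_simp at h
    linarith
  have hCpos : 0 < cos (ζ + γ) := by
    refine (mul_pos_iff_of_pos_left ha0).1 ?_
    have hge : m ≤ a * cos (ζ + γ) := by rw [hC]; nlinarith
    by_contra! hneg
    nlinarith
  have hrange := abs_lt_pi_div_two_of_cos_pos (x := ζ + γ)
    (by linarith [hγ.1, pi_pos]) (by linarith [hγ.2, pi_pos]) hCpos
  rw [crossingAngle, ← hp, ← hS, arcsin_sin hrange.1.le hrange.2.le, ← hγdef]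
  ring

lemma two_mul_add_arccos_le_pi {a b d θ : ℝ} (ha : 0 < a) (hab : a ≤ b) (hθ0 : 0 < θ)
    (hθ1 : θ < π / 2) (hd0 : 0 ≤ d) (hd : d ^ 2 = a ^ 2 + b ^ 2 - 2 * a * b * cos (2 * θ)) :
    2 * θ + arccos ((d ^ 2 + a ^ 2 - b ^ 2) / (2 * a * d)) ≤ π := by
  have hb := ha.trans_le hab
  have hc1 := cos_le_one (2 * θ)
  have hc2 := neg_one_le_cos (2 * θ)
  have hc3 : cos (2 * θ) < 1 := by
    have := strictAntiOn_cos (a := 0) (b := 2 * θ) ⟨le_rfl, pi_pos.le⟩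
      ⟨by linarith, by linarith⟩ (by linarith)
    simpa using this
  set c := cos (2 * θ) with hc
  have hab0 := mul_pos ha hb
  have hdpos : 0 < d := by
    refine hd0.lt_of_ne fun h => ?_
    rw [← h] at hd
    nlinarith [sq_nonneg (a - b)]
  have hd1 : d ≤ a + b := by
    refine (sq_le_sq₀ hd0 (by positivity)).1 ?_
    nlinarith
  have hd2 : b - a ≤ d := by
    refine (sq_le_sq₀ (sub_nonneg.2 hab) hd0).1 ?_
    nlinarith
  have key : -c ≤ (d ^ 2 + a ^ 2 - b ^ 2) / (2 * a * d) := by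
    rw [le_div_iff₀ (by positivity), hd]
    have : c * (b - d) ≤ a := by
      refine (le_abs_self _).trans ?_
      rw [abs_mul, ← one_mul a]
      exact mul_le_mul (abs_le.2 ⟨hc2, hc1⟩) (abs_le.2 ⟨by linarith, by linarith⟩)
        (abs_nonneg _) zero_le_one
    nlinarith
  have h := antitone_arccos key
  rw [hc, arccos_neg, arccos_cos (by linarith) (by linarith)] at h
  linarith

/-- The iteration map `f` of the geometric algorithm is a contraction with
constant `1/2` on the interval `[0, φ⊥]`. -/
theorem iterationMap_contraction
    (r rA rB θ : ℝ)
    (hr : 0 < r) (hrA : r < rA) (hAB : rA ≤ rB)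
    (hθ0 : 0 < θ) (hθ1 : θ < Real.pi / 2)
    (A B : EuclideanSpace ℝ (Fin 2))
    (hA : A = ![rA * Real.cos θ, rA * Real.sin θ])
    (hB : B = ![rB * Real.cos θ, -(rB * Real.sin θ)])
    (M : ℝ → EuclideanSpace ℝ (Fin 2))
    (hM : ∀ φ, M φ = ![r * Real.cos φ, r * Real.sin φ])
    (A' : ℝ → EuclideanSpace ℝ (Fin 2))
    (hA'mem : ∀ φ, A' φ ∈ segment ℝ (M φ) B)
    (hA'norm : ∀ φ, ‖A' φ‖ = rA)
    (ψ : ℝ → ℝ)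
    (hψrange : ∀ φ, ψ φ ∈ Set.Ioc (-Real.pi) Real.pi)
    (hψpolar : ∀ φ, A' φ = ![rA * Real.cos (ψ φ), rA * Real.sin (ψ φ)])
    (f : ℝ → ℝ) (hf : ∀ φ, f φ = (θ + ψ φ) / 2)
    (dAB φperp : ℝ) (hdAB : dAB = dist A B)
    (hφperp : φperp = θ + Real.arccos ((dAB ^ 2 + rA ^ 2 - rB ^ 2) / (2 * rA * dAB)) - Real.pi / 2)
    (hclear : Real.cos (2 * θ) >
      (r ^ 2 - Real.sqrt ((rA ^ 2 - r ^ 2) * (rB ^ 2 - r ^ 2))) / (rA * rB))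
    :
    ∀ φ ∈ Set.Icc 0 φperp, ∀ ψ' ∈ Set.Icc 0 φperp,
      |f φ - f ψ'| ≤ (1 / 2) * |φ - ψ'| := by
  have hrA0 := hr.trans hrA
  have hdAB_sq : dAB ^ 2 = rA ^ 2 + rB ^ 2 - 2 * rA * rB * cos (2 * θ) := by
    rw [hdAB, EuclideanSpace.dist_eq, sq_sqrt (by positivity)]
    simp only [Fin.sum_univ_two, hA, hB, Real.dist_eq, sq_abs, cos_two_mul]
    simp only [Matrix.cons_val_zero, Matrix.cons_val_one]
    linear_combination (rA + rB) ^ 2 * sin_sq_add_cos_sq θ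
  have hperp : φperp + θ ≤ π / 2 := by
    have := two_mul_add_arccos_le_pi hrA0 hAB hθ0 hθ1 (hdAB ▸ dist_nonneg) hdAB_sq
    linarith
  have hψ : ∀ φ ∈ Set.Icc 0 φperp, ψ φ + θ = crossingAngle r rA rB (φ + θ) := by
    rintro φ ⟨h0, h1⟩
    obtain ⟨s, t, hs, ht, hst, h⟩ := hA'mem φ
    obtain rfl : s = 1 - t := by linarith
    have hx : rA * cos (ψ φ) = (1 - t) * (r * cos φ) + t * (rB * cos θ) := by
      have := congrArg (fun v : EuclideanSpace ℝ (Fin 2) => v 0) h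
      simpa [hM, hB, hψpolar] using this.symm
    have hy : rA * sin (ψ φ) = (1 - t) * (r * sin φ) - t * (rB * sin θ) := by
      have := congrArg (fun v : EuclideanSpace ℝ (Fin 2) => v 1) h
      simpa [hM, hB, hψpolar, sub_eq_add_neg] using this.symm
    obtain ⟨hl, hu⟩ := hψrange φ
    refine eq_crossingAngle hr hrA hAB ?_ ht (by linarith) (by linarith) (by linarith) ?_ ?_
    · exact cos_nonneg_of_neg_pi_div_two_le_of_le (by linarith) (by linarith)
    · rw [cos_add, cos_add]
      linear_combination cos θ * hx - sin θ * hy + t * rB * sin_sq_add_cos_sq θ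
    · rw [sin_add, sin_add]
      linear_combination cos θ * hy + sin θ * hx
  intro φ hφ φ' hφ'
  have h := abs_crossingAngle_sub_le hr hrA hAB (φ + θ) (φ' + θ)
  rw [← hψ φ hφ, ← hψ φ' hφ', add_sub_add_right_eq_sub, add_sub_add_right_eq_sub] at h
  rw [hf, hf, show (θ + ψ φ) / 2 - (θ + ψ φ') / 2 = 1 / 2 * (ψ φ - ψ φ') by ring, abs_mul,
    abs_of_pos (by norm_num : (0 : ℝ) < 1 / 2)]
  gcongr
end

section
/- Assume cos(2θ) > (r² − √((r_A² − r²)·(r_B² − r²)))/(r_A·r_B). Then the iteration map f maps the interval [0, φ_⊥] into itself and has exactly one fixed point in [0, φ_⊥]: there exists a unique φ_M ∈ [0, φ_⊥] with f(φ_M) = φ_M. -/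
open Real

/-- The clear-view hypothesis says that the angle `2θ` is smaller than
`arccos (r / rA) + arccos (r / rB)`. -/
lemma not_both_below_horizon {r rA rB θ u v : ℝ} (hr : 0 < r) (hrA : r < rA) (hrB : r < rB)
    (hθ : 2 * θ ≤ π)
    (hclear : cos (2 * θ) > (r ^ 2 - √((rA ^ 2 - r ^ 2) * (rB ^ 2 - r ^ 2))) / (rA * rB))
    (hu : 0 ≤ u) (hv : 0 ≤ v) (huv : u + v = 2 * θ)
    (hA : rA * cos u ≤ r) (hB : rB * cos v ≤ r) : False := by
  have hA0 : 0 < rA := hr.trans hrA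
  have hB0 : 0 < rB := hr.trans hrB
  have ha : arccos (r / rA) ≤ u := by
    rw [← arccos_cos hu (by linarith)]
    exact arccos_le_arccos (by rw [le_div_iff₀ hA0]; linarith)
  have hb : arccos (r / rB) ≤ v := by
    rw [← arccos_cos hv (by linarith)]
    exact arccos_le_arccos (by rw [le_div_iff₀ hB0]; linarith)
  have h := cos_le_cos_of_nonneg_of_le_pi
    (add_nonneg (arccos_nonneg (r / rA)) (arccos_nonneg (r / rB))) hθ (by linarith)
  have cosArccos : ∀ {R : ℝ}, 0 < R → r < R → cos (arccos (r / R)) = r / R := fun hR hrR =>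
    cos_arccos (by linarith [div_pos hr hR]) (by rw [div_le_one hR]; exact hrR.le)
  have sinArccos : ∀ {R : ℝ}, 0 < R → sin (arccos (r / R)) = √(R ^ 2 - r ^ 2) / R := by
    intro R hR
    rw [sin_arccos, show 1 - (r / R) ^ 2 = (R ^ 2 - r ^ 2) / R ^ 2 by field_simp,
      sqrt_div' _ (sq_nonneg R), sqrt_sq hR.le]
  rw [cos_add, cosArccos hA0 hrA, cosArccos hB0 hrB, sinArccos hA0, sinArccos hB0] at h
  rw [sqrt_mul (by nlinarith)] at hclear
  have e : (r ^ 2 - √(rA ^ 2 - r ^ 2) * √(rB ^ 2 - r ^ 2)) / (rA * rB)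
      = r / rA * (r / rB) - √(rA ^ 2 - r ^ 2) / rA * (√(rB ^ 2 - r ^ 2) / rB) := by
    field_simp
  linarith

/-- The angle at `r` under which the point of polar coordinates `(R, u)` is seen
increases with `u`. -/
lemma view_angle_strictMono {r R u v : ℝ} (hr : 0 < r) (hR : r < R) (hu : 0 ≤ u) (huv : u < v)
    (hv : v < π) :
    R * sin u * (R * cos v - r) < R * sin v * (R * cos u - r) := by
  set δ := (v - u) / 2 with hδ
  set m := (u + v) / 2 with hm
  have hs : 0 < sin δ := sin_pos_of_pos_of_lt_pi (by linarith) (by linarith)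
  have hc : 0 < cos δ := cos_pos_of_mem_Ioo ⟨by linarith, by linarith⟩
  have hcm : cos m ≤ cos δ := cos_le_cos_of_nonneg_of_le_pi (by linarith) (by linarith)
    (by linarith)
  have key : 0 < sin δ * (R * cos δ - r * cos m) :=
    mul_pos hs (by nlinarith)
  have eu : u = m - δ := by rw [hm, hδ]; ring
  have ev : v = m + δ := by rw [hm, hδ]; ring
  have e : R * sin v * (R * cos u - r) - R * sin u * (R * cos v - r)
      = 2 * R * (sin δ * (R * cos δ - r * cos m)) := by
    rw [eu, ev, sin_add, sin_sub, cos_add, cos_sub]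
    linear_combination (2 * R ^ 2 * sin δ * cos δ) * sin_sq_add_cos_sq m
  have : 0 < 2 * R * (sin δ * (R * cos δ - r * cos m)) := by
    have : 0 < R := hr.trans hR
    positivity
  linarith

/-- The reflection law at `M_φ` has at most one solution on the illuminated arc. -/
lemma reflection_unique {r rA rB θ x y : ℝ} (hr : 0 < r) (hrA : r < rA) (hrB : r < rB)
    (hθ : θ < π / 2) (hx : 0 ≤ x) (hxy : x < y) (hy : y ≤ θ)
    (hXx : 0 < rA * cos (θ - x) - r) (hYx : 0 < rB * cos (θ + x) - r)
    (hXy : 0 < rA * cos (θ - y) - r) (hYy : 0 < rB * cos (θ + y) - r)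
    (ex : rB * sin (θ + x) * (rA * cos (θ - x) - r)
      = rA * sin (θ - x) * (rB * cos (θ + x) - r))
    (ey : rB * sin (θ + y) * (rA * cos (θ - y) - r)
      = rA * sin (θ - y) * (rB * cos (θ + y) - r)) : False := by
  have h1 := view_angle_strictMono hr hrB (u := θ + x) (v := θ + y) (by linarith) (by linarith)
    (by linarith)
  have h2 := view_angle_strictMono hr hrA (u := θ - y) (v := θ - x) (by linarith) (by linarith)
    (by linarith)
  generalize rA * cos (θ - x) - r = X₁ at *
  generalize rB * cos (θ + x) - r = Y₁ at *
  generalize rA * cos (θ - y) - r = X₂ at *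
  generalize rB * cos (θ + y) - r = Y₂ at *
  generalize rB * sin (θ + x) = p₁ at *
  generalize rB * sin (θ + y) = p₂ at *
  generalize rA * sin (θ - x) = q₁ at *
  generalize rA * sin (θ - y) = q₂ at *
  have k1 := mul_lt_mul_of_pos_right h1 (mul_pos hXx hXy)
  have k2 := mul_lt_mul_of_pos_right h2 (mul_pos hYx hYy)
  have e1 : p₁ * Y₂ * (X₁ * X₂) = q₁ * X₂ * (Y₁ * Y₂) := by
    linear_combination (Y₂ * X₂) * ex
  have e2 : p₂ * Y₁ * (X₁ * X₂) = q₂ * X₁ * (Y₁ * Y₂) := by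
    linear_combination (Y₁ * X₁) * ey
  linarith

/-- Polar description of the foot of the perpendicular from the origin to the line `AB`. -/
lemma perpendicular_foot_spec {rA rB θ d φ : ℝ} (hA : 0 < rA) (hAB : rA ≤ rB)
    (hθ0 : 0 < θ) (hθ1 : θ < π / 2) (hd0 : 0 ≤ d)
    (hd : d ^ 2 = rA ^ 2 + rB ^ 2 - 2 * rA * rB * cos (2 * θ))
    (hφ : φ = θ + arccos ((d ^ 2 + rA ^ 2 - rB ^ 2) / (2 * rA * d)) - π / 2) :
    rA * cos (θ - φ) = rB * cos (θ + φ) ∧ 0 ≤ φ ∧ θ + φ < π / 2 := by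
  have hB : 0 < rB := hA.trans_le hAB
  have hs : 0 < sin (2 * θ) := sin_pos_of_pos_of_lt_pi (by linarith) (by linarith)
  have hsc := sin_sq_add_cos_sq (2 * θ)
  have hc1 : cos (2 * θ) < 1 := by nlinarith
  have hdsq : d ^ 2 = (rA - rB * cos (2 * θ)) ^ 2 + (rB * sin (2 * θ)) ^ 2 := by
    linear_combination hd - rB ^ 2 * hsc
  have hdpos : 0 < d := by
    refine lt_of_le_of_ne hd0 fun h => ?_
    rw [← h] at hdsq
    have : 0 < (rB * sin (2 * θ)) ^ 2 := by positivity
    nlinarith [sq_nonneg (rA - rB * cos (2 * θ))]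
  have hc : (d ^ 2 + rA ^ 2 - rB ^ 2) / (2 * rA * d) = (rA - rB * cos (2 * θ)) / d := by
    rw [hd]; field_simp; ring
  rw [hc] at hφ
  have hsq : 1 - ((rA - rB * cos (2 * θ)) / d) ^ 2 = (rB * sin (2 * θ) / d) ^ 2 := by
    field_simp
    linarith
  set α := arccos ((rA - rB * cos (2 * θ)) / d) with hα
  have hα0 : 0 ≤ α := arccos_nonneg _
  have hαπ : α ≤ π := arccos_le_pi _
  have habs : ((rA - rB * cos (2 * θ)) / d) ^ 2 ≤ 1 := by
    nlinarith [sq_nonneg (rB * sin (2 * θ) / d)]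
  have hcosα : cos α = (rA - rB * cos (2 * θ)) / d :=
    cos_arccos (by nlinarith) (by nlinarith)
  have hsinα : sin α = rB * sin (2 * θ) / d := by
    rw [hα, sin_arccos, hsq, sqrt_sq (by positivity)]
  have e1 : cos (θ - φ) = rB * sin (2 * θ) / d := by
    rw [show θ - φ = π / 2 - α by rw [hφ]; ring, cos_pi_div_two_sub, hsinα]
  have e2 : cos (θ + φ) = rA * sin (2 * θ) / d := by
    rw [show θ + φ = (2 * θ + α) - π / 2 by rw [hφ]; ring, cos_sub_pi_div_two, sin_add, hcosα,
      hsinα]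
    ring
  have e3 : sin (θ + φ) = (rB - rA * cos (2 * θ)) / d := by
    rw [show θ + φ = (2 * θ + α) - π / 2 by rw [hφ]; ring, sin_sub_pi_div_two, cos_add, hcosα,
      hsinα]
    field_simp
    linear_combination rB * hsc
  have hc2 : 0 < cos (θ + φ) := by rw [e2]; positivity
  have hs2 : 0 < sin (θ + φ) := by
    rw [e3]
    exact div_pos (by nlinarith) hdpos
  have hlt : θ + φ < π / 2 := by
    by_contra! h
    exact absurd (cos_nonpos_of_pi_div_two_le_of_le h (by linarith)) (not_le.2 hc2)
  have hpos : 0 < θ + φ := by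
    by_contra! h
    exact absurd (sin_nonpos_of_nonpos_of_neg_pi_le h (by linarith)) (not_le.2 hs2)
  have heq : rA * cos (θ - φ) = rB * cos (θ + φ) := by rw [e1, e2]; ring
  refine ⟨heq, ?_, hlt⟩
  by_contra! h
  have := cos_lt_cos_of_nonneg_of_le_pi hpos.le (y := θ - φ) (by linarith) (by linarith)
  nlinarith

/-- The reflection law at `M_φ` has an illuminated solution between `0` and the foot of the
perpendicular. -/
lemma exists_reflection {r rA rB θ φ₀ : ℝ} (hr : 0 < r) (hrA : r < rA) (hAB : rA ≤ rB)
    (hθ0 : 0 < θ) (hθ1 : θ < π / 2)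
    (hclear : cos (2 * θ) > (r ^ 2 - √((rA ^ 2 - r ^ 2) * (rB ^ 2 - r ^ 2))) / (rA * rB))
    (hfoot : rA * cos (θ - φ₀) = rB * cos (θ + φ₀)) (hφ₀ : 0 ≤ φ₀)
    (hfar : φ₀ < θ → r ≤ rA * cos (θ - φ₀)) :
    ∃ φ ∈ Set.Icc 0 φ₀, φ ≤ θ ∧ 0 < rA * cos (θ - φ) - r ∧ 0 < rB * cos (θ + φ) - r ∧
      rB * sin (θ + φ) * (rA * cos (θ - φ) - r)
        = rA * sin (θ - φ) * (rB * cos (θ + φ) - r) := by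
  have hA0 : 0 < rA := hr.trans hrA
  have hB0 : 0 < rB := hA0.trans_le hAB
  have hcθ : 0 < cos θ := cos_pos_of_mem_Ioo ⟨by linarith, hθ1⟩
  have hsθ : 0 < sin θ := sin_pos_of_pos_of_lt_pi hθ0 (by linarith)
  have hs2 : 0 < sin (2 * θ) := sin_pos_of_pos_of_lt_pi (by linarith) (by linarith)
  have hqp : ∀ φ, 0 ≤ φ → φ ≤ θ → rA * sin (θ - φ) ≤ rB * sin (θ + φ) := by
    intro φ h0 h1
    have h2 : 0 ≤ sin φ := sin_nonneg_of_nonneg_of_le_pi h0 (by linarith)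
    have h3 : 0 ≤ sin (θ - φ) := sin_nonneg_of_nonneg_of_le_pi (by linarith) (by linarith)
    have h4 : sin (θ - φ) ≤ sin (θ + φ) := by
      rw [sin_add, sin_sub]
      nlinarith
    exact mul_le_mul hAB h4 h3 hB0.le
  set h : ℝ → ℝ := fun φ => rB * sin (θ + φ) * (rA * cos (θ - φ) - r)
    - rA * sin (θ - φ) * (rB * cos (θ + φ) - r) with hh
  have hcont : Continuous h := by fun_prop
  have hzero : h 0 ≤ 0 := by
    have e : h 0 = -(r * sin θ * (rB - rA)) := by
      simp only [hh, add_zero, sub_zero]; ring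
    rw [e, neg_nonpos]
    exact mul_nonneg (by positivity) (by linarith)
  have hend : 0 ≤ h (min θ φ₀) := by
    rcases le_or_gt θ φ₀ with hle | hlt
    · have e : h θ = rB * sin (2 * θ) * (rA - r) := by
        simp only [hh, sub_self, cos_zero, sin_zero, ← two_mul]; ring
      rw [min_eq_left hle, e]
      exact mul_nonneg (by positivity) (by linarith)
    · have e : h φ₀ = (rB * sin (θ + φ₀) - rA * sin (θ - φ₀)) * (rA * cos (θ - φ₀) - r) := by
        simp only [hh, ← hfoot]; ring
      rw [min_eq_right hlt.le, e]
      exact mul_nonneg (by linarith [hqp φ₀ hφ₀ hlt.le]) (by linarith [hfar hlt])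
  obtain ⟨φ, ⟨h0, h1⟩, hφ⟩ := intermediate_value_Icc (le_min hθ0.le hφ₀) hcont.continuousOn
    ⟨hzero, hend⟩
  have hφθ : φ ≤ θ := h1.trans (min_le_left _ _)
  have heq : rB * sin (θ + φ) * (rA * cos (θ - φ) - r)
      = rA * sin (θ - φ) * (rB * cos (θ + φ) - r) := sub_eq_zero.1 hφ
  have hlt : φ < θ := by
    refine lt_of_le_of_ne hφθ fun e => ?_
    rw [e, sub_self, cos_zero, sin_zero, ← two_mul] at heq
    have : 0 < rB * sin (2 * θ) * (rA * 1 - r) := mul_pos (by positivity) (by linarith)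
    linarith
  have hp : 0 < rB * sin (θ + φ) :=
    mul_pos hB0 (sin_pos_of_pos_of_lt_pi (by linarith) (by linarith))
  have hq : 0 < rA * sin (θ - φ) :=
    mul_pos hA0 (sin_pos_of_pos_of_lt_pi (by linarith) (by linarith))
  have hX : 0 < rA * cos (θ - φ) - r := by
    by_contra! hX
    have hY : rB * cos (θ + φ) - r ≤ 0 := by
      by_contra! hY
      nlinarith [mul_pos hq hY]
    exact not_both_below_horizon hr hrA (hrA.trans_le hAB) (by linarith) hclear
      (u := θ - φ) (v := θ + φ) (by linarith) (by linarith) (by ring) (by linarith) (by linarith)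
  have hY : 0 < rB * cos (θ + φ) - r := by
    by_contra! hY
    nlinarith [mul_pos hp hX]
  exact ⟨φ, ⟨h0, h1.trans (min_le_right _ _)⟩, hφθ, hX, hY, heq⟩

/-- The relation `rA e^{iψ} = (1 - t) r e^{iφ} + t rB e^{-iθ}`, which says that the point of
polar coordinates `(rA, ψ)` divides the segment from `M_φ` to `B` in the ratio `t : 1 - t`. -/
def OnSegmentPolar (r rA rB θ φ ψ t : ℝ) : Prop :=
  rA * cos ψ = (1 - t) * (r * cos φ) + t * (rB * cos θ) ∧
    rA * sin ψ = (1 - t) * (r * sin φ) - t * (rB * sin θ)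

namespace OnSegmentPolar

variable {r rA rB θ φ ψ t : ℝ}

lemma cos_sub (h : OnSegmentPolar r rA rB θ φ ψ t) (ω : ℝ) :
    rA * cos (ψ - ω) = (1 - t) * (r * cos (φ - ω)) + t * (rB * cos (θ + ω)) := by
  rw [Real.cos_sub, Real.cos_sub, cos_add]
  linear_combination cos ω * h.1 + sin ω * h.2

lemma sin_sub (h : OnSegmentPolar r rA rB θ φ ψ t) (ω : ℝ) :
    rA * sin (ψ - ω) = (1 - t) * (r * sin (φ - ω)) - t * (rB * sin (θ + ω)) := by
  rw [Real.sin_sub, Real.sin_sub, sin_add]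
  linear_combination cos ω * h.2 - sin ω * h.1

lemma pos (h : OnSegmentPolar r rA rB θ φ ψ t) (hr : 0 < r) (hrA : r < rA) (ht : 0 ≤ t) :
    0 < t := by
  refine lt_of_le_of_ne ht fun e => ?_
  obtain ⟨h1, h2⟩ := h
  rw [← e] at h1 h2
  have : rA ^ 2 = r ^ 2 := by
    have e1 : (rA * cos ψ) ^ 2 = (r * cos φ) ^ 2 := by rw [h1]; ring
    have e2 : (rA * sin ψ) ^ 2 = (r * sin φ) ^ 2 := by rw [h2]; ring
    linear_combination e1 + e2 + (r ^ 2) * sin_sq_add_cos_sq φ - rA ^ 2 * sin_sq_add_cos_sq ψ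
  nlinarith

lemma ratio_unique {ψ' t' : ℝ} (h : OnSegmentPolar r rA rB θ φ ψ t)
    (h' : OnSegmentPolar r rA rB θ φ ψ' t') (hr : 0 < r) (hrA : r < rA) (ht : 0 ≤ t)
    (ht' : 0 ≤ t') : t = t' := by
  have hpos := h.pos hr hrA ht
  have hpos' := h'.pos hr hrA ht'
  set a := rB * cos θ - r * cos φ with ha
  set b := -(rB * sin θ) - r * sin φ with hb
  set m := r * cos φ * a + r * sin φ * b with hm
  have quad : ∀ {ψ t : ℝ}, OnSegmentPolar r rA rB θ φ ψ t →
      t * (2 * m + t * (a ^ 2 + b ^ 2)) = rA ^ 2 - r ^ 2 := by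
    intro ψ t h
    have e1 : (rA * cos ψ) ^ 2 = (r * cos φ + t * a) ^ 2 := by rw [h.1, ha]; ring
    have e2 : (rA * sin ψ) ^ 2 = (r * sin φ + t * b) ^ 2 := by rw [h.2, hb]; ring
    rw [hm]
    linear_combination -e1 - e2 - (r ^ 2) * sin_sq_add_cos_sq φ
      + rA ^ 2 * sin_sq_add_cos_sq ψ
  have q := quad h
  have q' := quad h'
  have hk : 0 ≤ a ^ 2 + b ^ 2 := by positivity
  have hfac : 0 < 2 * m + t * (a ^ 2 + b ^ 2) := by
    refine pos_of_mul_pos_right ?_ ht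
    rw [q]
    nlinarith
  have hprod : (t - t') * (2 * m + t * (a ^ 2 + b ^ 2) + t' * (a ^ 2 + b ^ 2)) = 0 := by
    linear_combination q - q'
  have hne : 2 * m + t * (a ^ 2 + b ^ 2) + t' * (a ^ 2 + b ^ 2) ≠ 0 := by positivity
  exact sub_eq_zero.1 ((mul_eq_zero.1 hprod).resolve_right hne)

lemma nonneg_angle (h : OnSegmentPolar r rA rB θ φ ψ t) (hr : 0 < r) (hA : 0 < rA)
    (ht1 : t ≤ 1) (hψ : ψ ∈ Set.Ioc (-π) π) (hθ0 : 0 < θ)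
    (hφ : 0 ≤ θ + φ) (hφ' : θ + φ ≤ π) : 0 ≤ θ + ψ := by
  by_contra! hneg
  have h1 := h.sin_sub (-θ)
  rw [add_neg_cancel, sin_zero, sub_neg_eq_add, sub_neg_eq_add] at h1
  have h2 : 0 ≤ sin (φ + θ) := sin_nonneg_of_nonneg_of_le_pi (by linarith) (by linarith)
  have h3 : sin (ψ + θ) < 0 := sin_neg_of_neg_of_neg_pi_lt (by linarith) (by linarith [hψ.1])
  have h4 : 0 ≤ (1 - t) * (r * sin (φ + θ)) := mul_nonneg (by linarith) (by positivity)
  nlinarith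

lemma angle_le {φ₀ : ℝ} (h : OnSegmentPolar r rA rB θ φ ψ t) (hr : 0 < r) (hA : 0 < rA)
    (hB : 0 < rB) (ht0 : 0 < t) (ht1 : t ≤ 1) (hψ : ψ ∈ Set.Ioc (-π) π) (hθ0 : 0 < θ)
    (hφ : 0 ≤ φ) (hφφ₀ : φ ≤ φ₀) (hφ₀ : θ + φ₀ < π / 2)
    (hfoot : rA * cos (θ - φ₀) = rB * cos (θ + φ₀))
    (hfar : φ₀ < θ → r ≤ rA * cos (θ - φ₀)) : θ + ψ ≤ 2 * φ₀ := by
  have hneg : ψ ≤ φ₀ := by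
    by_contra! hlt
    have h1 := h.sin_sub φ₀
    have h2 : sin (φ - φ₀) ≤ 0 := sin_nonpos_of_nonpos_of_neg_pi_le (by linarith) (by linarith)
    have h3 : 0 < sin (θ + φ₀) := sin_pos_of_pos_of_lt_pi (by linarith) (by linarith)
    have h4 : 0 ≤ sin (ψ - φ₀) :=
      sin_nonneg_of_nonneg_of_le_pi (by linarith) (by linarith [hψ.2])
    have h5 : 0 ≤ (1 - t) * (r * -sin (φ - φ₀)) :=
      mul_nonneg (by linarith) (mul_nonneg hr.le (by linarith))
    have h6 : 0 < t * (rB * sin (θ + φ₀)) := by positivity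
    have h7 : 0 ≤ rA * sin (ψ - φ₀) := by positivity
    linarith
  rcases le_or_gt θ φ₀ with hle | hlt
  · linarith
  by_contra! hgt
  have h1 := h.cos_sub φ₀
  have h2 : r * cos (φ - φ₀) ≤ rA * cos (θ - φ₀) := by
    nlinarith [hfar hlt, cos_le_one (φ - φ₀)]
  have h3 : cos (θ - φ₀) < cos (φ₀ - ψ) :=
    cos_lt_cos_of_nonneg_of_le_pi (by linarith) (by linarith) (by linarith)
  rw [← hfoot, show ψ - φ₀ = -(φ₀ - ψ) by ring, cos_neg] at h1
  have h4 := mul_le_mul_of_nonneg_left h2 (sub_nonneg.2 ht1)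
  nlinarith

/-- If the iteration map fixes `φ`, then `φ` is illuminated and satisfies the reflection law. -/
lemma reflection_of_fixed (h : OnSegmentPolar r rA rB θ φ (2 * φ - θ) t) (hr : 0 < r)
    (hrA : r < rA) (hAB : rA ≤ rB) (ht0 : 0 < t) (hθ0 : 0 < θ) (hφ : 0 ≤ φ)
    (hφ' : θ + φ < π / 2)
    (hclear : cos (2 * θ) > (r ^ 2 - √((rA ^ 2 - r ^ 2) * (rB ^ 2 - r ^ 2))) / (rA * rB)) :
    φ ≤ θ ∧ 0 < rA * cos (θ - φ) - r ∧ 0 < rB * cos (θ + φ) - r ∧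
      rB * sin (θ + φ) * (rA * cos (θ - φ) - r)
        = rA * sin (θ - φ) * (rB * cos (θ + φ) - r) := by
  have hA0 : 0 < rA := hr.trans hrA
  have hB0 : 0 < rB := hA0.trans_le hAB
  have hs := h.sin_sub φ
  have hc := h.cos_sub φ
  rw [sub_self, sin_zero, show 2 * φ - θ - φ = -(θ - φ) by ring, sin_neg] at hs
  rw [sub_self, cos_zero, show 2 * φ - θ - φ = -(θ - φ) by ring, cos_neg] at hc
  have hp : 0 < sin (θ + φ) := sin_pos_of_pos_of_lt_pi (by linarith) (by linarith)
  have hφθ : φ ≤ θ := by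
    by_contra! hlt
    have h1 : sin (θ - φ) < 0 := sin_neg_of_neg_of_neg_pi_lt (by linarith) (by linarith)
    have h2 : 0 < t * (rB * sin (θ + φ)) := by positivity
    nlinarith
  have hXY : rA * cos (θ - φ) - r = t * (rB * cos (θ + φ) - r) := by linear_combination hc
  have hY : 0 < rB * cos (θ + φ) - r := by
    by_contra! hY
    have hX : rA * cos (θ - φ) - r ≤ 0 := by
      rw [hXY]; exact mul_nonpos_of_nonneg_of_nonpos ht0.le hY
    exact not_both_below_horizon hr hrA (hrA.trans_le hAB) (by linarith) hclear
      (u := θ - φ) (v := θ + φ) (by linarith) (by linarith) (by ring) (by linarith) (by linarith)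
  refine ⟨hφθ, by rw [hXY]; exact mul_pos ht0 hY, hY, ?_⟩
  rw [hXY]
  linear_combination (rB * cos (θ + φ) - r) * hs

end OnSegmentPolar

/-- The reflection law at an illuminated `M_φ` puts the mirror image of `A` on the segment
from `M_φ` to `B`. -/
lemma exists_onSegmentPolar_of_reflection {r rA rB θ φ : ℝ}
    (hp : 0 < rB * sin (θ + φ)) (hq : 0 ≤ rA * sin (θ - φ))
    (heq : rB * sin (θ + φ) * (rA * cos (θ - φ) - r)
      = rA * sin (θ - φ) * (rB * cos (θ + φ) - r)) :
    ∃ t, 0 ≤ t ∧ OnSegmentPolar r rA rB θ φ (2 * φ - θ) t := by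
  obtain ⟨t, ht⟩ : ∃ t, t = rA * sin (θ - φ) / (rB * sin (θ + φ)) := ⟨_, rfl⟩
  have hs : rA * sin (θ - φ) = t * (rB * sin (θ + φ)) := by
    rw [ht, div_mul_cancel₀ _ hp.ne']
  have hc : rA * cos (θ - φ) - r = t * (rB * cos (θ + φ) - r) := by
    refine mul_left_cancel₀ hp.ne' ?_
    rw [heq, hs]; ring
  have e1 : cos θ = cos (θ + φ) * cos φ + sin (θ + φ) * sin φ := by
    rw [← cos_sub, add_sub_cancel_right]
  have e2 : sin θ = sin (θ + φ) * cos φ - cos (θ + φ) * sin φ := by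
    rw [← sin_sub, add_sub_cancel_right]
  refine ⟨t, ht ▸ div_nonneg hq hp.le, ?_, ?_⟩
  · rw [show 2 * φ - θ = φ - (θ - φ) by ring, cos_sub φ, e1]
    linear_combination cos φ * hc + sin φ * hs
  · rw [show 2 * φ - θ = φ - (θ - φ) by ring, sin_sub φ, e2]
    linear_combination sin φ * hc - cos φ * hs

/-- The iteration map `f` maps the interval `[0, φ⊥]` into itself and has exactly
one fixed point there. -/
theorem iterationMap_mapsTo_and_uniqueFixedPoint
    (r rA rB θ : ℝ)
    (hr : 0 < r) (hrA : r < rA) (hAB : rA ≤ rB)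
    (hθ0 : 0 < θ) (hθ1 : θ < Real.pi / 2)
    (A B : EuclideanSpace ℝ (Fin 2))
    (hA : A = ![rA * Real.cos θ, rA * Real.sin θ])
    (hB : B = ![rB * Real.cos θ, -(rB * Real.sin θ)])
    (M : ℝ → EuclideanSpace ℝ (Fin 2))
    (hM : ∀ φ, M φ = ![r * Real.cos φ, r * Real.sin φ])
    (A' : ℝ → EuclideanSpace ℝ (Fin 2))
    (hA'mem : ∀ φ, A' φ ∈ segment ℝ (M φ) B)
    (hA'norm : ∀ φ, ‖A' φ‖ = rA)
    (ψ : ℝ → ℝ)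
    (hψrange : ∀ φ, ψ φ ∈ Set.Ioc (-Real.pi) Real.pi)
    (hψpolar : ∀ φ, A' φ = ![rA * Real.cos (ψ φ), rA * Real.sin (ψ φ)])
    (f : ℝ → ℝ) (hf : ∀ φ, f φ = (θ + ψ φ) / 2)
    (dAB φperp : ℝ) (hdAB : dAB = dist A B)
    (hφperp : φperp = θ + Real.arccos ((dAB ^ 2 + rA ^ 2 - rB ^ 2) / (2 * rA * dAB)) - Real.pi / 2)
    (hclear : Real.cos (2 * θ) >
      (r ^ 2 - Real.sqrt ((rA ^ 2 - r ^ 2) * (rB ^ 2 - r ^ 2))) / (rA * rB))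
    :
    (∀ φ ∈ Set.Icc 0 φperp, f φ ∈ Set.Icc 0 φperp) ∧
      ∃! φM, φM ∈ Set.Icc 0 φperp ∧ f φM = φM := by
  have hA0 : 0 < rA := hr.trans hrA
  have hB0 : 0 < rB := hA0.trans_le hAB
  have hrB : r < rB := hrA.trans_le hAB
  have hpolar : ∀ φ, ∃ t, 0 < t ∧ t ≤ 1 ∧ OnSegmentPolar r rA rB θ φ (ψ φ) t := by
    intro φ
    obtain ⟨a, t, ha, ht, hat, hseg⟩ := hA'mem φ
    have ha' : a = 1 - t := by linarith
    have h0 := congrArg (fun v : EuclideanSpace ℝ (Fin 2) => v 0) hseg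
    have h1 := congrArg (fun v : EuclideanSpace ℝ (Fin 2) => v 1) hseg
    simp only [PiLp.add_apply, PiLp.smul_apply, hM, hB, hψpolar, ha', smul_eq_mul,
      Matrix.cons_val_zero, Matrix.cons_val_one] at h0 h1
    have h : OnSegmentPolar r rA rB θ φ (ψ φ) t := ⟨by linarith, by linarith⟩
    exact ⟨t, h.pos hr hrA ht, by linarith, h⟩
  have hdsq : dAB ^ 2 = rA ^ 2 + rB ^ 2 - 2 * rA * rB * cos (2 * θ) := by
    rw [hdAB, EuclideanSpace.dist_eq, sq_sqrt (by positivity), Fin.sum_univ_two]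
    simp only [hA, hB, Real.dist_eq, sq_abs, Matrix.cons_val_zero, Matrix.cons_val_one]
    rw [cos_two_mul]
    linear_combination (rA + rB) ^ 2 * sin_sq_add_cos_sq θ
  obtain ⟨hfoot, hφ0, hφlt⟩ := perpendicular_foot_spec hA0 hAB hθ0 hθ1
    (hdAB ▸ dist_nonneg) hdsq hφperp
  have hfar : φperp < θ → r ≤ rA * cos (θ - φperp) := by
    intro hlt
    by_contra! hH
    exact not_both_below_horizon hr hrA hrB (by linarith) hclear (u := θ - φperp)
      (v := θ + φperp) (by linarith) (by linarith) (by ring) hH.le (hfoot ▸ hH.le)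
  refine ⟨fun φ hφ => ?_, ?_⟩
  · obtain ⟨t, ht0, ht1, h⟩ := hpolar φ
    have hlow := h.nonneg_angle hr hA0 ht1 (hψrange φ) hθ0 (by linarith [hφ.1])
      (by linarith [hφ.2])
    have hup := h.angle_le hr hA0 hB0 ht0 ht1 (hψrange φ) hθ0 hφ.1 hφ.2 hφlt hfoot hfar
    rw [hf]
    exact ⟨by linarith, by linarith⟩
  · obtain ⟨φ, hφ, hφθ, -, -, heq⟩ :=
      exists_reflection hr hrA hAB hθ0 hθ1 hclear hfoot hφ0 hfar
    have hfix : ∀ x ∈ Set.Icc 0 φperp, f x = x →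
        x ≤ θ ∧ 0 < rA * cos (θ - x) - r ∧ 0 < rB * cos (θ + x) - r ∧
        rB * sin (θ + x) * (rA * cos (θ - x) - r)
          = rA * sin (θ - x) * (rB * cos (θ + x) - r) := by
      intro x hx hfx
      obtain ⟨t, ht0, -, h⟩ := hpolar x
      rw [hf] at hfx
      rw [show ψ x = 2 * x - θ by linarith] at h
      exact h.reflection_of_fixed hr hrA hAB ht0 hθ0 hx.1 (by linarith [hx.2]) hclear
    have hφfix : f φ = φ := by
      obtain ⟨t, ht0, -, h⟩ := hpolar φ
      obtain ⟨t', ht0', h'⟩ := exists_onSegmentPolar_of_reflection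
        (mul_pos hB0 (sin_pos_of_pos_of_lt_pi (by linarith [hφ.1]) (by linarith [hφ.2])))
        (mul_nonneg hA0.le (sin_nonneg_of_nonneg_of_le_pi (by linarith) (by linarith [hφ.1])))
        heq
      obtain rfl := h.ratio_unique h' hr hrA ht0.le ht0'
      have hc : cos (ψ φ) = cos (2 * φ - θ) :=
        mul_left_cancel₀ hA0.ne' (h.1.trans h'.1.symm)
      have hs : sin (ψ φ) = sin (2 * φ - θ) :=
        mul_left_cancel₀ hA0.ne' (h.2.trans h'.2.symm)
      have hone : cos (ψ φ - (2 * φ - θ)) = 1 := by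
        rw [cos_sub, hc, hs]
        linear_combination sin_sq_add_cos_sq (2 * φ - θ)
      have := (cos_eq_one_iff_of_lt_of_lt (by linarith [(hψrange φ).1])
        (by linarith [(hψrange φ).2, hφ.1])).1 hone
      rw [hf]
      linarith
    refine ⟨φ, ⟨hφ, hφfix⟩, fun y ⟨hy, hyfix⟩ => ?_⟩
    obtain ⟨h1, h2, h3, h4⟩ := hfix φ hφ hφfix
    obtain ⟨k1, k2, k3, k4⟩ := hfix y hy hyfix
    rcases lt_trichotomy y φ with hlt | he | hgt
    · exact (reflection_unique hr hrA hrB hθ1 hy.1 hlt h1 k2 k3 h2 h3 k4 h4).elim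
    · exact he
    · exact (reflection_unique hr hrA hrB hθ1 hφ.1 hgt k1 h2 h3 k2 k3 h4 k4).elim
end

section
/- Assume cos(2θ) > (r² − √((r_A² − r²)·(r_B² − r²)))/(r_A·r_B), and let φ_M ∈ [0, φ_⊥] be the unique fixed point of f in [0, φ_⊥]. Then for every initial guess φ₀ ∈ [0, φ_⊥], the sequence of iterates f⁽ⁿ⁾(φ₀) converges to φ_M; moreover |f⁽ⁿ⁾(φ₀) − φ_M| ≤ (1/2)ⁿ·|φ₀ − φ_M| for all n. -/
open Real

namespace ReflectionIteration

/-- The angle of refraction `arcsin (k * sin x)` as a function of the angle of incidence `x`. -/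
noncomputable def refraction (k x : ℝ) : ℝ := arcsin (k * sin x)

/-- The derivative of `refraction k`. -/
noncomputable def refractionDeriv (k x : ℝ) : ℝ := 1 / √(1 - (k * sin x) ^ 2) * (k * cos x)

lemma sq_mul_sin_lt_one {k : ℝ} (hk0 : 0 < k) (hk1 : k < 1) (x : ℝ) : (k * sin x) ^ 2 < 1 := by
  rw [mul_pow]
  nlinarith [sin_sq_le_one x, sq_nonneg (sin x)]

lemma hasDerivAt_refraction {k : ℝ} (hk0 : 0 < k) (hk1 : k < 1) (x : ℝ) :
    HasDerivAt (refraction k) (refractionDeriv k x) x := by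
  have h := sq_mul_sin_lt_one hk0 hk1 x
  exact (hasDerivAt_arcsin (by nlinarith) (by nlinarith)).comp x ((hasDerivAt_sin x).const_mul k)

lemma abs_refractionDeriv_le_one {k : ℝ} (hk0 : 0 < k) (hk1 : k < 1) (x : ℝ) :
    |refractionDeriv k x| ≤ 1 := by
  have h := sq_mul_sin_lt_one hk0 hk1 x
  have hs : 0 < √(1 - (k * sin x) ^ 2) := sqrt_pos.2 (by linarith)
  rw [refractionDeriv, one_div_mul_eq_div, abs_div, abs_of_pos hs, div_le_one hs]
  have : (k * sin x) ^ 2 + (k * cos x) ^ 2 = k ^ 2 := by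
    linear_combination k ^ 2 * sin_sq_add_cos_sq x
  apply abs_le_sqrt
  nlinarith

lemma two_mul_refractionDeriv_le {a b : ℝ} (hb0 : 0 < b) (hba : b ≤ a) (ha1 : a < 1) (x : ℝ) :
    2 * refractionDeriv b x ≤ 1 + refractionDeriv a x := by
  have ha0 := hb0.trans_le hba
  have hA := abs_le.1 (abs_refractionDeriv_le_one ha0 ha1 x)
  have hsa : 0 < √(1 - (a * sin x) ^ 2) :=
    sqrt_pos.2 (by linarith [sq_mul_sin_lt_one ha0 ha1 x])
  rcases le_total 0 (cos x) with hc | hc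
  · have : refractionDeriv b x ≤ refractionDeriv a x := by
      unfold refractionDeriv
      have : (b * sin x) ^ 2 ≤ (a * sin x) ^ 2 := by
        rw [mul_pow, mul_pow]; gcongr
      gcongr
    linarith
  · have : refractionDeriv b x ≤ 0 :=
      mul_nonpos_of_nonneg_of_nonpos (by positivity) (mul_nonpos_of_nonneg_of_nonpos hb0.le hc)
    linarith

lemma monotone_sub_refraction {k : ℝ} (hk0 : 0 < k) (hk1 : k < 1) :
    Monotone fun x => x - refraction k x :=
  monotone_of_hasDerivAt_nonneg
    (fun x => (hasDerivAt_id x).sub (hasDerivAt_refraction hk0 hk1 x))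
    fun x => sub_nonneg.2 (abs_le.1 (abs_refractionDeriv_le_one hk0 hk1 x)).2

lemma monotone_add_refraction_sub {a b : ℝ} (hb0 : 0 < b) (hba : b ≤ a) (ha1 : a < 1) :
    Monotone fun x => x + refraction a x - 2 * refraction b x :=
  monotone_of_hasDerivAt_nonneg
    (fun x => ((hasDerivAt_id x).add (hasDerivAt_refraction (hb0.trans_le hba) ha1 x)).sub
      ((hasDerivAt_refraction hb0 (hba.trans_lt ha1) x).const_mul 2))
    fun x => sub_nonneg.2 (two_mul_refractionDeriv_le hb0 hba ha1 x)

lemma abs_refraction_sub_le {a b : ℝ} (hb0 : 0 < b) (hba : b ≤ a) (ha1 : a < 1) (x y : ℝ) :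
    |(refraction a x - refraction b x) - (refraction a y - refraction b y)| ≤
      |(x - refraction b x) - (y - refraction b y)| := by
  wlog h : y ≤ x generalizing x y
  · rw [abs_sub_comm, abs_sub_comm (x - _)]
    exact this y x (le_of_not_ge h)
  have h₁ := monotone_sub_refraction (hb0.trans_le hba) ha1 h
  have h₂ := monotone_add_refraction_sub hb0 hba ha1 h
  dsimp only at h₁ h₂
  refine abs_le.2 ⟨?_, ?_⟩ <;> linarith [le_abs_self ((x - refraction b x) - (y - refraction b y))]

lemma exists_sub_refraction_eq (k t : ℝ) : ∃ x, x - refraction k x = t := by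
  have hc : Continuous fun x => x - refraction k x := by
    unfold refraction; fun_prop
  refine mem_range_of_exists_le_of_exists_ge hc ⟨t - π / 2, ?_⟩ ⟨t + π / 2, ?_⟩
  · linarith [neg_pi_div_two_le_arcsin (k * sin (t - π / 2)),
      show refraction k (t - π / 2) = arcsin _ from rfl]
  · linarith [arcsin_le_pi_div_two (k * sin (t + π / 2)),
      show refraction k (t + π / 2) = arcsin _ from rfl]

lemma sin_refraction {k : ℝ} (hk0 : 0 < k) (hk1 : k < 1) (x : ℝ) :
    sin (refraction k x) = k * sin x := by
  have h := sq_mul_sin_lt_one hk0 hk1 x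
  exact sin_arcsin (by nlinarith) (by nlinarith)

lemma abs_refraction_sub_refraction_lt {a b : ℝ} (hb0 : 0 < b) (hba : b ≤ a) (ha1 : a < 1)
    (x : ℝ) : |refraction a x - refraction b x| < π / 2 := by
  have h := sq_mul_sin_lt_one (hb0.trans_le hba) ha1 x
  have h₁ : refraction a x < π / 2 := arcsin_lt_pi_div_two.2 (by nlinarith)
  have h₂ : -(π / 2) < refraction a x := neg_pi_div_two_lt_arcsin.2 (by nlinarith)
  rw [abs_lt]
  rcases le_total 0 (sin x) with hs | hs
  · have h₃ : 0 ≤ refraction b x := arcsin_nonneg.2 (by positivity)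
    have h₄ : refraction b x ≤ refraction a x := monotone_arcsin (by gcongr)
    constructor <;> linarith [pi_pos]
  · have h₃ : refraction b x ≤ 0 := arcsin_nonpos.2 (mul_nonpos_of_nonneg_of_nonpos hb0.le hs)
    have h₄ : refraction a x ≤ refraction b x :=
      monotone_arcsin (mul_le_mul_of_nonpos_right hba hs)
    constructor <;> linarith [pi_pos]

/-- A point on a horizontal segment joining a point of norm `r` to a point with nonnegative
abscissa has positive abscissa as soon as its norm exceeds `r`, so its polar angle is an arcsine. -/
lemma cos_eq_cos_of_sin_eq_sin {r rA c d α χ x l m : ℝ} (hr : 0 < r) (hrA : r < rA)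
    (hα : 0 ≤ cos α) (hd : 0 ≤ d) (hl : 0 ≤ l) (hm : 0 ≤ m) (hlm : l + m = 1)
    (hc : c = r * cos x) (hh : rA * sin α = r * sin x)
    (hX : rA * cos χ = l * c + m * d) (hY : sin χ = sin α) : cos χ = cos α := by
  have hsq : cos χ ^ 2 = cos α ^ 2 := by
    linarith [sin_sq_add_cos_sq χ, sin_sq_add_cos_sq α, congrArg (· ^ 2) hY]
  rcases sq_eq_sq_iff_eq_or_eq_neg.1 hsq with h | h
  · exact h
  · exfalso
    have h₁ : r * |cos x| < rA * cos α := by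
      apply lt_of_pow_lt_pow_left₀ 2 (mul_nonneg (hr.trans hrA).le hα)
      rw [mul_pow, sq_abs]
      have : (rA * sin α) ^ 2 = (r * sin x) ^ 2 := by rw [hh]
      have : (rA * cos α) ^ 2 - r ^ 2 * cos x ^ 2 = rA ^ 2 - r ^ 2 := by
        linear_combination rA ^ 2 * sin_sq_add_cos_sq α - r ^ 2 * sin_sq_add_cos_sq x - this
      nlinarith
    have h₂ : -(r * |cos x|) ≤ r * cos x := by nlinarith [neg_abs_le (cos x)]
    have h₃ : 0 ≤ r * |cos x| := by positivity
    have h₄ : rA * cos χ = -(rA * cos α) := by rw [h]; ring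
    have h₅ : l * -(r * |cos x|) ≤ l * c := by rw [hc]; gcongr
    nlinarith [mul_nonneg hm hd, mul_nonneg hm h₃]

/-- The polar angle `ψ` of the point of norm `rA` on the segment from the point of norm `r` and
polar angle `φ` to the point of norm `rB` and polar angle `-θ`, in terms of the angle `x`
between the segment and the radius at its starting point. -/
lemma polar_angle_eq {r rA rB θ φ ψ x l m : ℝ} (hr : 0 < r) (hrA : r < rA) (hAB : rA ≤ rB)
    (hθ0 : 0 < θ) (hθ1 : θ < π / 2) (hψ : ψ ∈ Set.Ioc (-π) π)
    (hl : 0 ≤ l) (hm : 0 ≤ m) (hlm : l + m = 1)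
    (h0 : l * (r * cos φ) + m * (rB * cos θ) = rA * cos ψ)
    (h1 : l * (r * sin φ) + m * -(rB * sin θ) = rA * sin ψ)
    (hx : x - refraction (r / rB) x = φ + θ) :
    ψ = -θ + (refraction (r / rA) x - refraction (r / rB) x) := by
  have hA0 : 0 < rA := hr.trans hrA
  have hB0 : 0 < rB := hA0.trans_le hAB
  have ha0 : 0 < r / rA := by positivity
  have ha1 : r / rA < 1 := (div_lt_one hA0).2 hrA
  have hb0 : 0 < r / rB := by positivity
  have hba : r / rB ≤ r / rA := by gcongr
  have hab := abs_lt.1 (abs_refraction_sub_refraction_lt hb0 hba ha1 x)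
  have hsa : rA * sin (refraction (r / rA) x) = r * sin x := by
    rw [sin_refraction ha0 ha1]; field_simp
  have hsb : rB * sin (refraction (r / rB) x) = r * sin x := by
    rw [sin_refraction hb0 (hba.trans_lt ha1)]; field_simp
  have hca : 0 ≤ cos (refraction (r / rA) x) := cos_arcsin_nonneg _
  have hcb : 0 ≤ cos (refraction (r / rB) x) := cos_arcsin_nonneg _
  set α := refraction (r / rA) x
  set β := refraction (r / rB) x
  have hx' : x = φ + (θ + β) := by linarith
  have cx : cos x = cos φ * cos (θ + β) - sin φ * sin (θ + β) := by
    rw [← cos_add, ← hx']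
  have sx : sin x = sin φ * cos (θ + β) + cos φ * sin (θ + β) := by
    rw [← sin_add, ← hx']
  have eβ : β = -θ + (θ + β) := by ring
  have cβ : cos β = cos θ * cos (θ + β) + sin θ * sin (θ + β) := by
    conv_lhs => rw [eβ, cos_add, cos_neg, sin_neg]
    ring
  have sβ : sin β = cos θ * sin (θ + β) - sin θ * cos (θ + β) := by
    conv_lhs => rw [eβ, sin_add, cos_neg, sin_neg]
    ring
  have hX : rA * cos (ψ + (θ + β)) = l * (r * cos x) + m * (rB * cos β) := by
    rw [cβ, cx, cos_add ψ]
    linear_combination (-cos (θ + β)) * h0 + sin (θ + β) * h1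
  have hY : rA * sin (ψ + (θ + β)) = l * (r * sin x) + m * (rB * sin β) := by
    rw [sβ, sx, sin_add ψ]
    linear_combination (-sin (θ + β)) * h0 - cos (θ + β) * h1
  have hsin : sin (ψ + (θ + β)) = sin α := by
    apply mul_left_cancel₀ hA0.ne'
    rw [hY, hsb, hsa, ← add_mul, hlm, one_mul]
  have hcos := cos_eq_cos_of_sin_eq_sin hr hrA hca (mul_nonneg hB0.le hcb) hl hm hlm rfl hsa hX hsin
  obtain ⟨k, hk⟩ := Angle.angle_eq_iff_two_pi_dvd_sub.1 (Angle.cos_sin_inj hcos hsin)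
  have hpi := pi_pos
  obtain rfl : k = 0 := by
    have h₁ : (k : ℝ) < 1 := by nlinarith [hψ.2]
    have h₂ : (-1 : ℝ) < k := by nlinarith [hψ.1]
    have h₃ : k < 1 := by exact_mod_cast h₁
    have h₄ : -1 < k := by exact_mod_cast h₂
    omega
  simp only [Int.cast_zero, mul_zero] at hk
  linarith

end ReflectionIteration

/-- The iterates of the geometric algorithm converge to the unique fixed point
`φM`, with geometric rate `1/2`. -/
theorem iterationMap_iterates_tendsto_fixedPoint
    (r rA rB θ : ℝ)
    (hr : 0 < r) (hrA : r < rA) (hAB : rA ≤ rB)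
    (hθ0 : 0 < θ) (hθ1 : θ < Real.pi / 2)
    (A B : EuclideanSpace ℝ (Fin 2))
    (hA : A = ![rA * Real.cos θ, rA * Real.sin θ])
    (hB : B = ![rB * Real.cos θ, -(rB * Real.sin θ)])
    (M : ℝ → EuclideanSpace ℝ (Fin 2))
    (hM : ∀ φ, M φ = ![r * Real.cos φ, r * Real.sin φ])
    (A' : ℝ → EuclideanSpace ℝ (Fin 2))
    (hA'mem : ∀ φ, A' φ ∈ segment ℝ (M φ) B)
    (hA'norm : ∀ φ, ‖A' φ‖ = rA)
    (ψ : ℝ → ℝ)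
    (hψrange : ∀ φ, ψ φ ∈ Set.Ioc (-Real.pi) Real.pi)
    (hψpolar : ∀ φ, A' φ = ![rA * Real.cos (ψ φ), rA * Real.sin (ψ φ)])
    (f : ℝ → ℝ) (hf : ∀ φ, f φ = (θ + ψ φ) / 2)
    (dAB φperp : ℝ) (hdAB : dAB = dist A B)
    (hφperp : φperp = θ + Real.arccos ((dAB ^ 2 + rA ^ 2 - rB ^ 2) / (2 * rA * dAB)) - Real.pi / 2)
    (hclear : Real.cos (2 * θ) >
      (r ^ 2 - Real.sqrt ((rA ^ 2 - r ^ 2) * (rB ^ 2 - r ^ 2))) / (rA * rB))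
    (φM : ℝ) (hφM : φM ∈ Set.Icc 0 φperp) (hfix : f φM = φM)
    (huniq : ∀ x ∈ Set.Icc 0 φperp, f x = x → x = φM) :
    ∀ φ₀ ∈ Set.Icc 0 φperp,
      Filter.Tendsto (fun n => f^[n] φ₀) Filter.atTop (nhds φM) ∧
      ∀ n : ℕ, |f^[n] φ₀ - φM| ≤ (1 / 2) ^ n * |φ₀ - φM| := by
  have hA0 : 0 < rA := hr.trans hrA
  have hB0 : 0 < rB := hA0.trans_le hAB
  have hangle : ∀ φ, ∃ x, x - ReflectionIteration.refraction (r / rB) x = φ + θ ∧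
      ψ φ = -θ + (ReflectionIteration.refraction (r / rA) x -
        ReflectionIteration.refraction (r / rB) x) := by
    intro φ
    obtain ⟨x, hx⟩ := ReflectionIteration.exists_sub_refraction_eq (r / rB) (φ + θ)
    obtain ⟨l, m, hl, hm, hlm, h⟩ := hA'mem φ
    have h0 : l * M φ 0 + m * B 0 = A' φ 0 := by rw [← h]; simp
    have h1 : l * M φ 1 + m * B 1 = A' φ 1 := by rw [← h]; simp
    rw [hM, hB, hψpolar] at h0 h1
    exact ⟨x, hx, ReflectionIteration.polar_angle_eq hr hrA hAB hθ0 hθ1 (hψrange φ) hl hm hlm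
      (by simpa using h0) (by simpa using h1) hx⟩
  have hcontr : ∀ φ, |f φ - φM| ≤ 1 / 2 * |φ - φM| := by
    intro φ
    obtain ⟨x, hx, hψx⟩ := hangle φ
    obtain ⟨y, hy, hψy⟩ := hangle φM
    have h := ReflectionIteration.abs_refraction_sub_le (a := r / rA) (b := r / rB)
      (by positivity) (by gcongr) ((div_lt_one hA0).2 hrA) x y
    rw [hx, hy, add_sub_add_right_eq_sub] at h
    have h₁ : f φ - φM = 1 / 2 * (ψ φ - ψ φM) := by
      linear_combination hf φ - hf φM + hfix
    rw [h₁, abs_mul, abs_of_pos (one_half_pos (α := ℝ)), hψx, hψy, add_sub_add_left_eq_sub]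
    gcongr
  intro φ₀ _
  have hrate : ∀ n : ℕ, |f^[n] φ₀ - φM| ≤ (1 / 2) ^ n * |φ₀ - φM| := by
    intro n
    induction n with
    | zero => simp
    | succ n ih =>
      rw [Function.iterate_succ_apply', pow_succ', mul_assoc]
      exact (hcontr _).trans (by gcongr)
  refine ⟨tendsto_iff_dist_tendsto_zero.2 (squeeze_zero (fun _ => dist_nonneg) hrate ?_), hrate⟩
  simpa using (tendsto_pow_atTop_nhds_zero_of_lt_one (r := (1 / 2 : ℝ))
    (by norm_num) (by norm_num)).mul_const |φ₀ - φM|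
end

section
/- If cos(2θ) = (r² − √((r_A² − r²)·(r_B² − r²)))/(r_A·r_B), then the line through A = r_A(cos θ, sin θ) and B = r_B(cos θ, −sin θ) is tangent to the circle of radius r centered at the origin; that is, the distance from the origin to this line equals r. -/
open Real

/-- If the squared distance from the origin to the point of parameter `s` on the line through
`A` and `B` is `r ^ 2 + (p - s * d) ^ 2` with `d ≠ 0`, then the line is at distance `r`. -/
theorem infDist_affineSpan_pair_of_norm_sq_lineMap
    {E : Type*} [NormedAddCommGroup E] [NormedSpace ℝ E] {A B : E} {r p d : ℝ}
    (hr : 0 ≤ r) (hd : d ≠ 0)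
    (h : ∀ s : ℝ, ‖AffineMap.lineMap A B s‖ ^ 2 = r ^ 2 + (p - s * d) ^ 2) :
    Metric.infDist (0 : E) ((affineSpan ℝ {A, B} : AffineSubspace ℝ E) : Set E) = r := by
  apply le_antisymm
  · have hfoot : ‖AffineMap.lineMap A B (p / d)‖ = r := by
      have hsq := h (p / d)
      rw [div_mul_cancel₀ _ hd, sub_self, zero_pow two_ne_zero, add_zero] at hsq
      exact (sq_eq_sq₀ (norm_nonneg _) hr).1 hsq
    have hle := Metric.infDist_le_dist_of_mem (x := (0 : E))
      (AffineMap.lineMap_mem_affineSpan_pair (p / d) A B)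
    rwa [dist_zero_left, hfoot] at hle
  · refine (Metric.le_infDist ⟨A, left_mem_affineSpan_pair ℝ A B⟩).2 fun X hX => ?_
    obtain ⟨s, rfl⟩ := mem_affineSpan_pair_iff_exists_lineMap_eq.1 hX
    rw [dist_zero_left]
    refine (sq_le_sq₀ hr (norm_nonneg _)).1 ?_
    rw [h s]
    exact le_add_of_nonneg_right (sq_nonneg _)

/-- If `cos(2θ)` attains the critical value, then the line through the focal points
`A` and `B` is tangent to the circle of radius `r` centered at the origin. -/
theorem line_tangent_at_critical_angle
    (r rA rB θ : ℝ)
    (hr : 0 < r) (hrA : r < rA) (hAB : rA ≤ rB)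
    (hθ0 : 0 < θ) (hθ1 : θ < Real.pi / 2)
    (hcrit : Real.cos (2 * θ) =
      (r ^ 2 - Real.sqrt ((rA ^ 2 - r ^ 2) * (rB ^ 2 - r ^ 2))) / (rA * rB))
    (A B : EuclideanSpace ℝ (Fin 2))
    (hA : A = ![rA * Real.cos θ, rA * Real.sin θ])
    (hB : B = ![rB * Real.cos θ, -(rB * Real.sin θ)]) :
    Metric.infDist (0 : EuclideanSpace ℝ (Fin 2))
      ((affineSpan ℝ {A, B} : AffineSubspace ℝ (EuclideanSpace ℝ (Fin 2))) :
        Set (EuclideanSpace ℝ (Fin 2))) = r := by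
  have hrA0 : 0 < rA := hr.trans hrA
  have hrB : r < rB := hrA.trans_le hAB
  have hrB0 : 0 < rB := hr.trans hrB
  have hpA : 0 < rA ^ 2 - r ^ 2 := by nlinarith
  have hpB : 0 < rB ^ 2 - r ^ 2 := by nlinarith
  rw [Real.sqrt_mul hpA.le, eq_div_iff (mul_pos hrA0 hrB0).ne', Real.cos_two_mul'] at hcrit
  have hp := Real.sqrt_pos.2 hpA
  have hq := Real.sqrt_pos.2 hpB
  have hp2 := Real.sq_sqrt hpA.le
  have hq2 := Real.sq_sqrt hpB.le
  set p := Real.sqrt (rA ^ 2 - r ^ 2)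
  set q := Real.sqrt (rB ^ 2 - r ^ 2)
  have hcs := Real.sin_sq_add_cos_sq θ
  refine infDist_affineSpan_pair_of_norm_sq_lineMap (p := p) (d := p + q) hr.le
    (add_pos hp hq).ne' fun s => ?_
  have hA0 : A 0 = rA * Real.cos θ := by simp [hA]
  have hA1 : A 1 = rA * Real.sin θ := by simp [hA]
  have hB0 : B 0 = rB * Real.cos θ := by simp [hB]
  have hB1 : B 1 = -(rB * Real.sin θ) := by simp [hB]
  rw [EuclideanSpace.real_norm_sq_eq, Fin.sum_univ_two]
  simp only [AffineMap.lineMap_apply_module, PiLp.add_apply, PiLp.smul_apply, smul_eq_mul,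
    hA0, hA1, hB0, hB1]
  linear_combination ((1 - s) ^ 2 * rA ^ 2 + s ^ 2 * rB ^ 2) * hcs
    + 2 * s * (1 - s) * hcrit - (1 - s) ^ 2 * hp2 - s ^ 2 * hq2
end

section
/- Assume cos(2θ) > (r² − √((r_A² − r²)·(r_B² − r²)))/(r_A·r_B). If φ ∈ [−θ, θ] is such that M_φ satisfies the specular condition (the unoriented angle between A − M_φ and M_φ equals the unoriented angle between B − M_φ and M_φ), then 0 ≤ φ ≤ φ_⊥, where φ_⊥ = θ + arccos((d_AB² + r_A² − r_B²)/(2·r_A·d_AB)) − π/2 and d_AB = dist(A, B). -/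
open Real

/-- Equal cosines, one of which is positive, and nonnegative second coordinates
make two plane vectors parallel and pointing into the same half plane. -/
lemma parallel_of_div_norm_eq {a₁ a₂ b₁ b₂ p q : ℝ} (hp : 0 < p) (hq : 0 < q)
    (hpa : p ^ 2 = a₁ ^ 2 + a₂ ^ 2) (hqb : q ^ 2 = b₁ ^ 2 + b₂ ^ 2)
    (ha₂ : 0 ≤ a₂) (hb₂ : 0 ≤ b₂) (hcos : a₁ / p = b₁ / q) (hpos : 0 < a₁ ∨ 0 < b₁) :
    0 < a₁ ∧ 0 < b₁ ∧ a₁ * b₂ = b₁ * a₂ := by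
  have ha : 0 < a₁ := by
    rcases hpos with h | h
    · exact h
    · have h' : 0 < a₁ / p := hcos ▸ div_pos h hq
      exact (div_pos_iff_of_pos_right hp).1 h'
  have hb : 0 < b₁ := by
    have h' : 0 < b₁ / q := hcos ▸ div_pos ha hp
    exact (div_pos_iff_of_pos_right hq).1 h'
  refine ⟨ha, hb, ?_⟩
  rw [div_eq_div_iff hp.ne' hq.ne'] at hcos
  have hsq : a₁ ^ 2 * q ^ 2 = b₁ ^ 2 * p ^ 2 := by
    rw [← mul_pow, ← mul_pow, hcos]
  rw [hpa, hqb] at hsq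
  refine (sq_eq_sq₀ (by positivity) (by positivity)).1 ?_
  linear_combination hsq

/-- If two points at distances `a, b` from the center subtend a central angle `x + y` whose
chord misses the circle of radius `r`, one of them lies above the tangent line
at the point splitting the central angle into `x` and `y`. -/
lemma above_tangent_of_clear {r a b x y : ℝ} (hr : 0 < r) (ha : r < a) (hb : r < b)
    (hx : 0 ≤ x) (hy : 0 ≤ y) (hxy : x + y ≤ π)
    (hclear : (r ^ 2 - √((a ^ 2 - r ^ 2) * (b ^ 2 - r ^ 2))) / (a * b) < cos (x + y)) :
    0 < a * cos x - r ∨ 0 < b * cos y - r := by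
  have ha0 : 0 < a := hr.trans ha
  have hb0 : 0 < b := hr.trans hb
  by_contra! h
  have arccos_le {c z : ℝ} (hc : 0 < c) (hz : 0 ≤ z) (hzπ : z ≤ π) (h : c * cos z - r ≤ 0) :
      arccos (r / c) ≤ z := by
    rw [← arccos_cos hz hzπ]
    apply arccos_le_arccos
    rw [le_div_iff₀ hc]
    linarith
  have hα := arccos_le ha0 hx (by linarith) h.1
  have hβ := arccos_le hb0 hy (by linarith) h.2
  have hcos := cos_le_cos_of_nonneg_of_le_pi
    (add_nonneg (arccos_nonneg (r / a)) (arccos_nonneg (r / b))) hxy (add_le_add hα hβ)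
  have cos_arc {c : ℝ} (hc : r < c) : cos (arccos (r / c)) = r / c := by
    have hc0 : 0 < c := hr.trans hc
    exact cos_arccos (by linarith [div_pos hr hc0]) ((div_le_one hc0).2 hc.le)
  have sin_arc {c : ℝ} (hc : r < c) : sin (arccos (r / c)) = √(c ^ 2 - r ^ 2) / c := by
    have hc0 : 0 < c := hr.trans hc
    rw [sin_arccos, show 1 - (r / c) ^ 2 = (c ^ 2 - r ^ 2) / c ^ 2 by field_simp,
      sqrt_div' _ (by positivity), sqrt_sq hc0.le]
  rw [cos_add (arccos _), cos_arc ha, cos_arc hb, sin_arc ha, sin_arc hb] at hcos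
  rw [sqrt_mul (by nlinarith)] at hclear
  have heq : (r ^ 2 - √(a ^ 2 - r ^ 2) * √(b ^ 2 - r ^ 2)) / (a * b) =
      r / a * (r / b) - √(a ^ 2 - r ^ 2) / a * (√(b ^ 2 - r ^ 2) / b) := by
    field_simp
  linarith

/-- When two points see the circle point under equal angles to the normal, the nearer one
is angularly closer to the normal. -/
lemma angle_le_of_specular {r a b x y : ℝ} (hr : 0 < r) (ha : 0 < a) (hab : a ≤ b)
    (hx : x ≤ π) (hy : 0 ≤ y)
    (hax : 0 < a * cos x - r)
    (hspec : (a * cos x - r) * (b * sin y) = (b * cos y - r) * (a * sin x)) : x ≤ y := by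
  by_contra! hyx
  have hb : 0 < b := ha.trans_le hab
  have hcosx : 0 < cos x := by
    by_contra! h
    nlinarith
  have hxpi : x < π / 2 := by
    by_contra! h
    linarith [cos_nonpos_of_pi_div_two_le_of_le h (by linarith [pi_pos])]
  have hcos : cos x < cos y := cos_lt_cos_of_nonneg_of_le_pi hy hx hyx
  have hsin : sin y < sin x := sin_lt_sin_of_lt_of_le_pi_div_two (by linarith [pi_pos]) hxpi.le hyx
  have hsy : 0 ≤ sin y := sin_nonneg_of_nonneg_of_le_pi hy (by linarith)
  have h₁ : (a * cos x - r) * b < (b * cos y - r) * a := by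
    nlinarith [mul_pos (mul_pos ha hb) (sub_pos.2 hcos), mul_nonneg hr.le (sub_nonneg.2 hab)]
  have h₂ : 0 < (b * cos y - r) * a := (mul_pos hax hb).trans h₁
  nlinarith [mul_nonneg (sub_pos.2 h₁).le hsy, mul_pos h₂ (sub_pos.2 hsin)]

/-- A point at distance `a > r` from the center is not on the circle of radius `r`. -/
lemma sq_add_sq_pos_of_lt {r a : ℝ} (hr : 0 < r) (ha : r < a) (x : ℝ) :
    0 < (a * cos x - r) ^ 2 + (a * sin x) ^ 2 := by
  have h : (a * cos x - r) ^ 2 + (a * sin x) ^ 2 =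
      (a - r) ^ 2 + 2 * (a * r) * (1 - cos x) := by
    linear_combination a ^ 2 * sin_sq_add_cos_sq x
  rw [h]
  have h₁ : 0 < (a - r) ^ 2 := pow_pos (sub_pos.2 ha) 2
  have h₂ : 0 ≤ 2 * (a * r) * (1 - cos x) :=
    mul_nonneg (mul_nonneg two_pos.le (mul_pos (hr.trans ha) hr).le) (sub_nonneg.2 (cos_le_one x))
  linarith

/-- When two points see the circle point under equal angles to the normal, the nearer one
has the smaller height over the tangent line. -/
lemma height_le_of_specular {r a b x y : ℝ} (hr : 0 < r) (ha : 0 < a) (hab : a ≤ b)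
    (hx : 0 ≤ x) (hy : 0 < y) (hyπ : y < π) (hxy : x ≤ y)
    (hby : 0 < b * cos y - r)
    (hspec : (a * cos x - r) * (b * sin y) = (b * cos y - r) * (a * sin x)) :
    a * cos x ≤ b * cos y := by
  have hb : 0 < b := ha.trans_le hab
  have hcosy : 0 < cos y := pos_of_mul_pos_right (hr.trans (sub_pos.1 hby)) hb.le
  have hypi : y < π / 2 := by
    by_contra! h
    linarith [cos_nonpos_of_pi_div_two_le_of_le h (by linarith)]
  have hsin : sin x ≤ sin y :=
    sin_le_sin_of_le_of_le_pi_div_two (by linarith [pi_pos]) hypi.le hxy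
  have hsx : 0 ≤ sin x := sin_nonneg_of_nonneg_of_le_pi hx (by linarith)
  have hmul : a * sin x ≤ b * sin y := mul_le_mul hab hsin hsx hb.le
  have hsy : 0 < b * sin y := mul_pos hb (sin_pos_of_pos_of_lt_pi hy hyπ)
  have := mul_le_mul_of_nonneg_left hmul hby.le
  have := le_of_mul_le_mul_right (hspec.trans_le this) hsy
  linarith

/-- In the triangle with sides `a`, `b` enclosing the angle `t` and third side `d`, the
difference of the heights of the endpoints of `d` in the direction at angle `x` from `a`. -/
lemma mul_cos_add_arccos_eq {a b t d : ℝ} (ha : 0 < a) (hb : 0 < b) (hd : 0 < d)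
    (ht : 0 ≤ sin t) (hdsq : d ^ 2 = a ^ 2 + b ^ 2 - 2 * a * b * cos t) (x : ℝ) :
    d * cos (x + arccos ((d ^ 2 + a ^ 2 - b ^ 2) / (2 * a * d))) =
      a * cos x - b * cos (t - x) := by
  have hsum : d ^ 2 = (a - b * cos t) ^ 2 + (b * sin t) ^ 2 := by
    linear_combination hdsq - b ^ 2 * sin_sq_add_cos_sq t
  have hc : (d ^ 2 + a ^ 2 - b ^ 2) / (2 * a * d) = (a - b * cos t) / d := by
    rw [hdsq]
    field_simp
    ring
  have habs : |a - b * cos t| ≤ d := abs_le_of_sq_le_sq (by nlinarith [sq_nonneg (b * sin t)]) hd.le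
  obtain ⟨hlo, hhi⟩ := abs_le.1 habs
  have hcos : d * cos (arccos ((a - b * cos t) / d)) = a - b * cos t := by
    rw [cos_arccos]
    · field_simp
    · rw [le_div_iff₀ hd]; linarith
    · rw [div_le_one hd]; exact hhi
  have hsin : d * sin (arccos ((a - b * cos t) / d)) = b * sin t := by
    refine (sq_eq_sq₀ (mul_nonneg hd.le ?_) (mul_nonneg hb.le ht)).1 ?_
    · exact sin_nonneg_of_nonneg_of_le_pi (arccos_nonneg _) (arccos_le_pi _)
    · have := sin_sq_add_cos_sq (arccos ((a - b * cos t) / d))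
      linear_combination d ^ 2 * this + hsum - congrArg (· ^ 2) hcos
  rw [hc, cos_add, cos_sub]
  linear_combination cos x * hcos - sin x * hsin

/-- Any specular reflection point with polar angle in `[−θ, θ]` lies on the arc
between the bisector of `∠AOB` and the foot of the perpendicular from the origin to
the line `AB`, i.e. its polar angle lies in `[0, φ⊥]`. -/
theorem specular_point_between_bisector_and_perpendicular_foot
    (r rA rB θ : ℝ)
    (hr : 0 < r) (hrA : r < rA) (hAB : rA ≤ rB)
    (hθ0 : 0 < θ) (hθ1 : θ < Real.pi / 2)
    (A B : EuclideanSpace ℝ (Fin 2))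
    (hA : A = ![rA * Real.cos θ, rA * Real.sin θ])
    (hB : B = ![rB * Real.cos θ, -(rB * Real.sin θ)])
    (M : ℝ → EuclideanSpace ℝ (Fin 2))
    (hM : ∀ φ, M φ = ![r * Real.cos φ, r * Real.sin φ])
    (hclear : Real.cos (2 * θ) >
      (r ^ 2 - Real.sqrt ((rA ^ 2 - r ^ 2) * (rB ^ 2 - r ^ 2))) / (rA * rB))
    (dAB φperp : ℝ) (hdAB : dAB = dist A B)
    (hφperp : φperp = θ + Real.arccos ((dAB ^ 2 + rA ^ 2 - rB ^ 2) / (2 * rA * dAB)) - Real.pi / 2)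
    (φ : ℝ) (hφ : φ ∈ Set.Icc (-θ) θ)
    (hspec : InnerProductGeometry.angle (A - M φ) (M φ)
      = InnerProductGeometry.angle (B - M φ) (M φ)) :
    0 ≤ φ ∧ φ ≤ φperp := by
  have hA0 : A 0 = rA * cos θ := by rw [hA]; rfl
  have hA1 : A 1 = rA * sin θ := by rw [hA]; rfl
  have hB0 : B 0 = rB * cos θ := by rw [hB]; rfl
  have hB1 : B 1 = -(rB * sin θ) := by rw [hB]; rfl
  have hM0 : M φ 0 = r * cos φ := by rw [hM]; rfl
  have hM1 : M φ 1 = r * sin φ := by rw [hM]; rfl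
  have hrA0 : 0 < rA := hr.trans hrA
  have hrB : r < rB := hrA.trans_le hAB
  have hrB0 : 0 < rB := hr.trans hrB
  obtain ⟨hφ₁, hφ₂⟩ := hφ
  have hsA : 0 ≤ sin (θ - φ) := sin_nonneg_of_nonneg_of_le_pi (by linarith) (by linarith)
  have hsB : 0 ≤ sin (θ + φ) := sin_nonneg_of_nonneg_of_le_pi (by linarith) (by linarith)
  have hpos := above_tangent_of_clear hr hrA hrB (x := θ - φ) (y := θ + φ) (by linarith)
    (by linarith) (by linarith) (by convert hclear using 2; ring)
  have hnM : ‖M φ‖ = r := by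
    refine (sq_eq_sq₀ (norm_nonneg _) hr.le).1 ?_
    rw [EuclideanSpace.real_norm_sq_eq, Fin.sum_univ_two, hM0, hM1]
    linear_combination r ^ 2 * sin_sq_add_cos_sq φ
  have hnA : ‖A - M φ‖ ^ 2 = (rA * cos (θ - φ) - r) ^ 2 + (rA * sin (θ - φ)) ^ 2 := by
    rw [EuclideanSpace.real_norm_sq_eq, Fin.sum_univ_two, PiLp.sub_apply, PiLp.sub_apply,
      hA0, hA1, hM0, hM1, mul_pow rA (sin _), sin_sq, cos_sub]
    linear_combination rA ^ 2 * sin_sq_add_cos_sq θ + r ^ 2 * sin_sq_add_cos_sq φ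
  have hnB : ‖B - M φ‖ ^ 2 = (rB * cos (θ + φ) - r) ^ 2 + (rB * sin (θ + φ)) ^ 2 := by
    rw [EuclideanSpace.real_norm_sq_eq, Fin.sum_univ_two, PiLp.sub_apply, PiLp.sub_apply,
      hB0, hB1, hM0, hM1, mul_pow rB (sin _), sin_sq, cos_add]
    linear_combination rB ^ 2 * sin_sq_add_cos_sq θ + r ^ 2 * sin_sq_add_cos_sq φ
  have hiA : inner ℝ (A - M φ) (M φ) = (rA * cos (θ - φ) - r) * r := by
    rw [PiLp.inner_apply, Fin.sum_univ_two, PiLp.sub_apply, PiLp.sub_apply,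
      hA0, hA1, hM0, hM1, cos_sub]
    simp only [RCLike.inner_apply, conj_trivial]
    linear_combination -r ^ 2 * sin_sq_add_cos_sq φ
  have hiB : inner ℝ (B - M φ) (M φ) = (rB * cos (θ + φ) - r) * r := by
    rw [PiLp.inner_apply, Fin.sum_univ_two, PiLp.sub_apply, PiLp.sub_apply,
      hB0, hB1, hM0, hM1, cos_add]
    simp only [RCLike.inner_apply, conj_trivial]
    linear_combination -r ^ 2 * sin_sq_add_cos_sq φ
  have hpA : 0 < ‖A - M φ‖ := by
    refine (norm_nonneg _).lt_of_ne fun h => (sq_add_sq_pos_of_lt hr hrA (θ - φ)).ne' ?_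
    rw [← hnA, ← h, zero_pow two_ne_zero]
  have hpB : 0 < ‖B - M φ‖ := by
    refine (norm_nonneg _).lt_of_ne fun h => (sq_add_sq_pos_of_lt hr hrB (θ + φ)).ne' ?_
    rw [← hnB, ← h, zero_pow two_ne_zero]
  have hcos := congrArg cos hspec
  rw [InnerProductGeometry.cos_angle, InnerProductGeometry.cos_angle, hiA, hiB, hnM,
    mul_div_mul_right _ _ hr.ne', mul_div_mul_right _ _ hr.ne'] at hcos
  obtain ⟨ha, hb, hpar⟩ := parallel_of_div_norm_eq hpA hpB hnA hnB
    (mul_nonneg hrA0.le hsA) (mul_nonneg hrB0.le hsB) hcos hpos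
  have hle := angle_le_of_specular hr hrA0 hAB (by linarith) (by linarith) ha hpar
  have hφ0 : 0 ≤ φ := by linarith
  refine ⟨hφ0, ?_⟩
  have hheight := height_le_of_specular hr hrA0 hAB (by linarith) (by linarith) (by linarith)
    hle hb hpar
  have hs2 : 0 < sin (2 * θ) := sin_pos_of_pos_of_lt_pi (by linarith) (by linarith)
  have hdsq : dAB ^ 2 = rA ^ 2 + rB ^ 2 - 2 * rA * rB * cos (2 * θ) := by
    rw [hdAB, dist_eq_norm, EuclideanSpace.real_norm_sq_eq, Fin.sum_univ_two, PiLp.sub_apply,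
      PiLp.sub_apply, hA0, hA1, hB0, hB1, cos_two_mul]
    linear_combination (rA + rB) ^ 2 * sin_sq_add_cos_sq θ
  have hd : 0 < dAB := by
    rw [hdAB, dist_pos]
    intro h
    have h1 : A 1 = B 1 := by rw [h]
    have hsθ : 0 < sin θ := sin_pos_of_pos_of_lt_pi hθ0 (by linarith)
    rw [hA1, hB1] at h1
    linarith [mul_pos hrA0 hsθ, mul_pos hrB0 hsθ]
  have hproj := mul_cos_add_arccos_eq hrA0 hrB0 hd hs2.le hdsq (θ - φ)
  rw [show 2 * θ - (θ - φ) = θ + φ by ring] at hproj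
  rw [hφperp]
  by_contra! h
  have := arccos_nonneg ((dAB ^ 2 + rA ^ 2 - rB ^ 2) / (2 * rA * dAB))
  have := mul_pos hd (cos_pos_of_mem_Ioo (x := θ - φ +
    arccos ((dAB ^ 2 + rA ^ 2 - rB ^ 2) / (2 * rA * dAB))) ⟨by linarith, by linarith⟩)
  linarith
end
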